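/- arXiv:1910.12509 — 2 statements merged into one kernel-verified Lean document; each statement's English description precedes it below -/
import Mathlib

section
/- Let λ be a non-trivial multiset of positive integers (i.e. |λ| < k_λ) with sum k_λ such that every odd element of λ equals 1, and let t be the multiplicity of 1 in λ. Then 2k_λ + t + 2 is the least integer n for which there exists a finite simple graph with chromatic number equal to k_λ, exactly n vertices, and which is not λ-choosable: such a graph on 2k_λ + t + 2 vertices exists, and every finite simple graph with chromatic number k_λ and fewer than 2k_λ + t + 2 vertices is λ-choosable. -/
open SimpleGraph

/-- `G` has a proper colouring from the lists `L`. -/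
def ListColourable {V : Type*} (G : SimpleGraph V) (L : V → Finset ℕ) : Prop :=
  ∃ f : V → ℕ, (∀ v, f v ∈ L v) ∧ ∀ ⦃u w⦄, G.Adj u w → f u ≠ f w

/-- `L` is a `lam`-list assignment: the elements `k_1, …, k_q` of the multiset `lam`
can be enumerated by a list `l`, and there are pairwise disjoint colour sets
`C 1, …, C q` such that `|L v ∩ C i| ≥ k_i` for every vertex `v` and every `i`. -/
def IsLamAssignment {V : Type*} (lam : Multiset ℕ) (L : V → Finset ℕ) : Prop :=
  ∃ (l : List ℕ) (C : Fin l.length → Finset ℕ),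
    (l : Multiset ℕ) = lam ∧
    (∀ i j, i ≠ j → Disjoint (C i) (C j)) ∧
    ∀ (v : V) (i : Fin l.length), l.get i ≤ ((L v) ∩ C i).card

/-- `G` is `lam`-choosable. -/
def LamChoosable {V : Type*} (G : SimpleGraph V) (lam : Multiset ℕ) : Prop :=
  ∀ L : V → Finset ℕ, IsLamAssignment lam L → ListColourable G L

/-- A vertex colouring from `L` on `X`, proper for the complete multipartite graph whose parts are
the fibres of `p`. -/
def PartColourable {V : Type*} (p : V → ℕ) (X : Finset V) (L : V → Finset ℕ) : Prop :=
  ∃ f : V → ℕ, (∀ v ∈ X, f v ∈ L v) ∧ ∀ u ∈ X, ∀ v ∈ X, f u = f v → p u = p v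

/-- Hall's theorem relative to a finset of indices. -/
theorem exists_injOn_of_hall {α β : Type*} [DecidableEq α] [DecidableEq β] [Nonempty β]
    (S : Finset α) (N : α → Finset β) (h : ∀ D ⊆ S, D.card ≤ (D.biUnion N).card) :
    ∃ M : α → β, (∀ a ∈ S, M a ∈ N a) ∧ ∀ a ∈ S, ∀ b ∈ S, M a = M b → a = b := by
  have key := (Finset.all_card_le_biUnion_card_iff_exists_injective
    (fun a : {a // a ∈ S} => N a.1)).1 ?_
  · obtain ⟨f, hf, hN⟩ := key
    refine ⟨fun a => if ha : a ∈ S then f ⟨a, ha⟩ else Classical.arbitrary β, ?_, ?_⟩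
    · intro a ha
      simp only [ha, dif_pos]
      exact hN ⟨a, ha⟩
    · intro a ha b hb hab
      simp only [ha, hb, dif_pos] at hab
      exact congrArg Subtype.val (hf hab)
  · intro s
    have h1 := h (s.map (Function.Embedding.subtype _)) (by
      intro x hx
      simp only [Finset.mem_map, Function.Embedding.subtype_apply] at hx
      obtain ⟨y, _, rfl⟩ := hx
      exact y.2)
    rw [Finset.card_map] at h1
    refine h1.trans (Finset.card_le_card ?_)
    intro x hx
    simp only [Finset.mem_biUnion, Finset.mem_map, Function.Embedding.subtype_apply] at hx ⊢
    obtain ⟨a, ⟨y, hy, rfl⟩, hx⟩ := hx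
    exact ⟨y, hy, hx⟩

section Ohba

variable {V : Type*} [Fintype V] [DecidableEq V]

/-- The set of all colours appearing in some list. -/
def pot (L : V → Finset ℕ) : Finset ℕ := Finset.univ.biUnion L

/-- The part of the multipartition `p` with label `a`. -/
def part (p : V → ℕ) (a : ℕ) : Finset V := Finset.univ.filter (fun v => p v = a)

/-- The vertices forming a part on their own. -/
def singles (p : V → ℕ) : Finset V := Finset.univ.filter (fun v => ∀ u, p u = p v → u = v)

/-- The labels of the parts with at least two vertices. -/
def bigLabels (p : V → ℕ) : Finset ℕ :=
  (Finset.univ.image p).filter (fun a => 1 < (part p a).card)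

/-- An extremal counterexample to Ohba's conjecture: minimal vertex set, smallest possible number
of colours, and lists that cannot be enlarged within these colours. -/
structure CriticalList (p : V → ℕ) (k : ℕ) (L : V → Finset ℕ) : Prop where
  nonempty : Nonempty V
  card_image : (Finset.univ.image p).card = k
  card_le : Fintype.card V ≤ 2 * k + 1
  le_card : ∀ v, k ≤ (L v).card
  not_col : ¬ PartColourable p Finset.univ L
  ih : ∀ (X : Finset V) (k' : ℕ) (L' : V → Finset ℕ), X.card < Fintype.card V →
    (X.image p).card ≤ k' → X.card ≤ 2 * k' + 1 → (∀ v ∈ X, k' ≤ (L' v).card) →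
    PartColourable p X L'
  pot_minimal : ∀ L' : V → Finset ℕ, (∀ v, k ≤ (L' v).card) →
    ¬ PartColourable p Finset.univ L' → (pot L).card ≤ (pot L').card
  maximal : ∀ v, ∀ c ∈ pot L, c ∉ L v →
    PartColourable p Finset.univ (Function.update L v (insert c (L v)))

@[simp] theorem mem_pot {L : V → Finset ℕ} {c : ℕ} : c ∈ pot L ↔ ∃ v, c ∈ L v := by
  simp [pot]

@[simp] theorem mem_part {p : V → ℕ} {a : ℕ} {v : V} : v ∈ part p a ↔ p v = a := by
  simp [part]

@[simp] theorem mem_singles {p : V → ℕ} {v : V} :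
    v ∈ singles p ↔ ∀ u, p u = p v → u = v := by
  simp [singles]

theorem mem_bigLabels {p : V → ℕ} {a : ℕ} : a ∈ bigLabels p ↔ 1 < (part p a).card := by
  simp only [bigLabels, Finset.mem_filter, Finset.mem_image, Finset.mem_univ, true_and,
    and_iff_right_iff_imp]
  intro h
  obtain ⟨v, hv⟩ := Finset.card_pos.1 (lt_trans Nat.zero_lt_one h)
  exact ⟨v, mem_part.1 hv⟩

theorem notMem_singles_iff {p : V → ℕ} {v : V} : v ∉ singles p ↔ p v ∈ bigLabels p := by
  rw [mem_bigLabels, Finset.one_lt_card, mem_singles]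
  constructor
  · intro h
    push Not at h
    obtain ⟨u, h1, h2⟩ := h
    exact ⟨u, by simpa using h1, v, by simp, h2⟩
  · rintro ⟨a, ha, b, hb, hab⟩ h
    rw [mem_part] at ha hb
    exact hab ((h a ha).trans (h b hb).symm)

theorem card_singles_add_card_bigLabels (p : V → ℕ) :
    (singles p).card + (bigLabels p).card = (Finset.univ.image p).card := by
  have h1 : ((singles p).image p).card = (singles p).card := by
    apply Finset.card_image_of_injOn
    intro u hu v hv h
    exact (mem_singles.1 hv) u h
  rw [← h1, ← Finset.card_union_of_disjoint]
  · congr 1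
    ext a
    simp only [Finset.mem_union, Finset.mem_image, Finset.mem_univ, true_and]
    constructor
    · rintro (⟨v, _, rfl⟩ | h)
      · exact ⟨v, rfl⟩
      · obtain ⟨v, hv⟩ := Finset.card_pos.1 (lt_trans Nat.zero_lt_one (mem_bigLabels.1 h))
        exact ⟨v, mem_part.1 hv⟩
    · rintro ⟨v, rfl⟩
      by_cases hv : v ∈ singles p
      · exact Or.inl ⟨v, hv, rfl⟩
      · exact Or.inr (notMem_singles_iff.1 hv)
  · rw [Finset.disjoint_left]
    intro a ha hb
    obtain ⟨v, hv, rfl⟩ := Finset.mem_image.1 ha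
    exact notMem_singles_iff.2 hb hv

theorem card_eq_sum_parts (p : V → ℕ) :
    Fintype.card V = (singles p).card + ∑ a ∈ bigLabels p, (part p a).card := by
  have h1 : (Finset.univ \ singles p).card = ∑ a ∈ bigLabels p, (part p a).card := by
    rw [Finset.card_eq_sum_card_fiberwise (f := p) (t := bigLabels p)]
    · refine Finset.sum_congr rfl fun a ha => ?_
      congr 1
      ext v
      simp only [Finset.mem_filter, Finset.mem_sdiff, Finset.mem_univ, true_and, mem_part]
      constructor
      · exact fun h => h.2
      · rintro rfl
        exact ⟨notMem_singles_iff.2 ha, rfl⟩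
    · intro v hv
      have hv' : v ∉ singles p := (Finset.mem_sdiff.1 hv).2
      exact notMem_singles_iff.1 hv'
  rw [← h1, Finset.card_sdiff_of_subset (Finset.subset_univ _), Finset.card_univ]
  have := Finset.card_le_univ (singles p)
  omega

namespace CriticalList

variable {p : V → ℕ} {k : ℕ} {L : V → Finset ℕ}

theorem k_pos (h : CriticalList p k L) : 0 < k := by
  obtain ⟨v⟩ := h.nonempty
  rw [← h.card_image]
  exact Finset.card_pos.2 ⟨p v, Finset.mem_image_of_mem _ (Finset.mem_univ _)⟩

theorem not_col' (h : CriticalList p k L) (f : V → ℕ) (hf : ∀ v, f v ∈ L v)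
    (hp : ∀ u v, f u = f v → p u = p v) : False :=
  h.not_col ⟨f, fun v _ => hf v, fun u _ v _ => hp u v⟩

theorem card_of_common (h : CriticalList p k L) {c : ℕ} {v₀ : V}
    (hc : ∀ v, p v = p v₀ → c ∈ L v) : 2 * k + (part p (p v₀)).card ≤ Fintype.card V := by
  by_contra hlt
  have hk := h.k_pos
  set X : Finset V := Finset.univ \ part p (p v₀) with hX
  have hP : 0 < (part p (p v₀)).card := Finset.card_pos.2 ⟨v₀, by simp⟩
  have hXc : X.card + (part p (p v₀)).card = Fintype.card V := by
    rw [hX, Finset.card_sdiff_of_subset (Finset.subset_univ _), Finset.card_univ]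
    have := Finset.card_le_univ (part p (p v₀))
    omega
  have hmem : ∀ v, v ∈ X ↔ p v ≠ p v₀ := by intro v; simp [hX]
  obtain ⟨f, hf, hp⟩ := h.ih X (k - 1) (fun v => (L v).erase c) (by omega) (by
      have : X.image p ⊆ (Finset.univ.image p).erase (p v₀) := by
        intro a ha
        obtain ⟨v, hv, rfl⟩ := Finset.mem_image.1 ha
        exact Finset.mem_erase.2 ⟨(hmem v).1 hv, Finset.mem_image_of_mem _ (Finset.mem_univ _)⟩
      have h2 := Finset.card_le_card this
      rw [Finset.card_erase_of_mem (Finset.mem_image_of_mem _ (Finset.mem_univ _)),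
        h.card_image] at h2
      exact h2) (by omega) (by
      intro v _
      have := h.le_card v
      have := Finset.pred_card_le_card_erase (s := L v) (a := c)
      omega)
  refine h.not_col' (fun v => if p v = p v₀ then c else f v) ?_ ?_
  · intro v
    by_cases hv : p v = p v₀
    · simp [hv, hc v hv]
    · simp only [hv, if_false]
      exact Finset.mem_of_mem_erase (hf v ((hmem v).2 hv))
  · intro u v huv
    by_cases hu : p u = p v₀ <;> by_cases hv : p v = p v₀
    · rw [hu, hv]
    · simp only [hu, hv, if_true, if_false] at huv
      exact absurd huv.symm (Finset.ne_of_mem_erase (hf v ((hmem v).2 hv)))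
    · simp only [hu, hv, if_true, if_false] at huv
      exact absurd huv (Finset.ne_of_mem_erase (hf u ((hmem u).2 hu)))
    · simp only [hu, hv, if_false] at huv
      exact hp u ((hmem u).2 hu) v ((hmem v).2 hv) huv

theorem exists_notMem (h : CriticalList p k L) {a : ℕ} (ha : a ∈ bigLabels p) (c : ℕ) :
    ∃ v, p v = a ∧ c ∉ L v := by
  by_contra! hc
  rw [mem_bigLabels] at ha
  obtain ⟨v₀, hv⟩ := Finset.card_pos.1 (lt_trans Nat.zero_lt_one ha)
  rw [mem_part] at hv
  subst hv
  have := h.card_of_common hc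
  have := h.card_le
  omega

theorem card_eq_of_single (h : CriticalList p k L) {v : V} (hv : v ∈ singles p) :
    Fintype.card V = 2 * k + 1 := by
  have hk := h.k_pos
  obtain ⟨c, hc⟩ := Finset.card_pos.1 (lt_of_lt_of_le hk (h.le_card v))
  have h1 := h.card_of_common (c := c) (v₀ := v) (by
    intro u hu
    rwa [mem_singles.1 hv u hu])
  have hP : 0 < (part p (p v)).card := Finset.card_pos.2 ⟨v, by simp⟩
  have := h.card_le
  omega

theorem exists_matching (h : CriticalList p k L) :
    ∃ M : ℕ → V, (∀ c ∈ pot L, c ∈ L (M c)) ∧ ∀ c ∈ pot L, ∀ d ∈ pot L, M c = M d → c = d := by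
  have := h.nonempty
  set N : ℕ → Finset V := fun c => Finset.univ.filter (fun v => c ∈ L v) with hN
  have hmN : ∀ c v, v ∈ N c ↔ c ∈ L v := by intro c v; simp [hN]
  by_contra hno
  have hbad : ∃ D ⊆ pot L, (D.biUnion N).card < D.card := by
    by_contra! hcon
    obtain ⟨M, hM, hinj⟩ := exists_injOn_of_hall (pot L) N hcon
    exact hno ⟨M, fun c hc => (hmN _ _).1 (hM c hc), hinj⟩
  obtain ⟨D, hD, hmin⟩ := (((pot L).powerset).filter
    (fun D => (D.biUnion N).card < D.card)).exists_min_image Finset.card (by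
      obtain ⟨D, h1, h2⟩ := hbad
      exact ⟨D, by simp only [Finset.mem_filter, Finset.mem_powerset]; exact ⟨h1, h2⟩⟩)
  simp only [Finset.mem_filter, Finset.mem_powerset] at hD hmin
  obtain ⟨hDp, hDc⟩ := hD
  obtain ⟨c₀, hc₀⟩ := Finset.card_pos.1 (lt_of_le_of_lt (Nat.zero_le _) hDc)
  obtain ⟨M, hM, hinj⟩ := exists_injOn_of_hall (D.erase c₀) N (by
    intro D' hD'
    by_contra! hlt
    have h1 := hmin D' ⟨(hD'.trans (Finset.erase_subset _ _)).trans hDp, hlt⟩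
    have h2 := Finset.card_le_card hD'
    rw [Finset.card_erase_of_mem hc₀] at h2
    have := Finset.card_pos.2 ⟨c₀, hc₀⟩
    omega)
  set X := D.biUnion N with hX
  have himg : (D.erase c₀).image M = X := by
    apply Finset.eq_of_subset_of_card_le
    · intro v hv
      obtain ⟨c, hc, rfl⟩ := Finset.mem_image.1 hv
      exact Finset.mem_biUnion.2 ⟨c, Finset.mem_of_mem_erase hc, hM c hc⟩
    · rw [Finset.card_image_of_injOn (fun a ha b hb hab => hinj a ha b hb hab),
        Finset.card_erase_of_mem hc₀]
      omega
  have hcol : ∀ v ∈ X, ∃ c ∈ D.erase c₀, M c = v := by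
    intro v hv
    rw [← himg] at hv
    simpa using Finset.mem_image.1 hv
  choose! g hgD hgM using hcol
  have hgL : ∀ v ∈ X, g v ∈ L v := fun v hv => by
    have := hM _ (hgD v hv)
    rwa [hgM v hv, hmN] at this
  have hginj : ∀ u ∈ X, ∀ v ∈ X, g u = g v → u = v := fun u hu v hv huv => by
    rw [← hgM u hu, ← hgM v hv, huv]
  have hout : ∀ v, v ∉ X → ∀ c ∈ D, c ∉ L v := fun v hv c hc hcv =>
    hv (Finset.mem_biUnion.2 ⟨c, hc, (hmN _ _).2 hcv⟩)
  by_cases hall : ∀ v, v ∈ X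
  · exact h.not_col' g (fun v => hgL v (hall v)) fun u v huv => by
      rw [hginj u (hall u) v (hall v) huv]
  push Not at hall
  obtain ⟨w, hw⟩ := hall
  set L' : V → Finset ℕ := fun v => if v ∈ X then L w else L v with hL'
  have hpot : (pot L').card < (pot L).card := by
    apply Finset.card_lt_card
    refine ⟨?_, ?_⟩
    · intro c hc
      obtain ⟨v, hv⟩ := mem_pot.1 hc
      by_cases hvX : v ∈ X
      · simp only [hL', hvX, if_true] at hv
        exact mem_pot.2 ⟨w, hv⟩
      · simp only [hL', hvX, if_false] at hv
        exact mem_pot.2 ⟨v, hv⟩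
    · intro hsub
      obtain ⟨v, hv⟩ := mem_pot.1 (hsub (hDp hc₀))
      by_cases hvX : v ∈ X
      · simp only [hL', hvX, if_true] at hv
        exact hout w hw c₀ hc₀ hv
      · simp only [hL', hvX, if_false] at hv
        exact hout v hvX c₀ hc₀ hv
  have hcol' : PartColourable p Finset.univ L' := by
    by_contra hbad'
    have := h.pot_minimal L' (by
      intro v
      by_cases hvX : v ∈ X
      · simp only [hL', hvX, if_true]; exact h.le_card w
      · simp only [hL', hvX, if_false]; exact h.le_card v) hbad'
    omega
  obtain ⟨f, hf, hp⟩ := hcol'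
  have hfL : ∀ v, v ∉ X → f v ∈ L v := fun v hv => by
    have := hf v (Finset.mem_univ _)
    simpa only [hL', hv, if_false] using this
  refine h.not_col' (fun v => if v ∈ X then g v else f v) ?_ ?_
  · intro v
    by_cases hv : v ∈ X
    · simp only [hv, if_true]; exact hgL v hv
    · simp only [hv, if_false]; exact hfL v hv
  · intro u v huv
    by_cases hu : u ∈ X <;> by_cases hv : v ∈ X
    · simp only [hu, hv, if_true] at huv
      rw [hginj u hu v hv huv]
    · simp only [hu, hv, if_true, if_false] at huv
      refine absurd (hfL v hv) (hout v hv _ ?_)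
      rw [← huv]
      exact Finset.mem_of_mem_erase (hgD u hu)
    · simp only [hu, hv, if_true, if_false] at huv
      refine absurd (hfL u hu) (hout u hu _ ?_)
      rw [huv]
      exact Finset.mem_of_mem_erase (hgD v hv)
    · simp only [hu, hv, if_false] at huv
      exact hp u (Finset.mem_univ _) v (Finset.mem_univ _) huv

theorem card_pot_lt (h : CriticalList p k L) : (pot L).card < Fintype.card V := by
  obtain ⟨M, hM, hinj⟩ := h.exists_matching
  have hcard : ((pot L).image M).card = (pot L).card :=
    Finset.card_image_of_injOn fun a ha b hb hab => hinj a ha b hb hab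
  by_contra hge
  have huniv : (pot L).image M = Finset.univ := by
    apply Finset.eq_univ_of_card
    have := Finset.card_le_univ ((pot L).image M)
    omega
  have hg : ∀ v, ∃ c ∈ pot L, M c = v := fun v => by
    have := Finset.mem_univ v
    rw [← huniv] at this
    simpa only [Finset.mem_image] using this
  choose g hg hgM using hg
  refine h.not_col' g (fun v => ?_) fun u v huv => ?_
  · have := hM _ (hg v)
    rwa [hgM] at this
  · rw [← hgM u, ← hgM v, huv]

/-- A colouring whose wild vertices form classes on their own can be made surjective onto the
pot. -/
theorem exists_surjective (h : CriticalList p k L) (Wd : V → ℕ → Prop) (f : V → ℕ)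
    (hfC : ∀ v, f v ∈ pot L) (hp : ∀ u v, f u = f v → p u = p v)
    (hacc : ∀ u, f u ∈ L u ∨ (Wd u (f u) ∧ ∀ w, f w = f u → w = u)) :
    ∃ f' : V → ℕ, (∀ v, f' v ∈ pot L) ∧ (∀ u v, f' u = f' v → p u = p v) ∧
      (∀ u, f' u ∈ L u ∨ (Wd u (f' u) ∧ ∀ w, f' w = f' u → w = u)) ∧
      ∀ c ∈ pot L, ∃ v, f' v = c := by
  classical
  obtain ⟨M, hM, hMinj⟩ := h.exists_matching
  set A : Finset (V → ℕ) := (Fintype.piFinset fun _ => pot L).filter (fun f =>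
    (∀ u v, f u = f v → p u = p v) ∧
      ∀ u, f u ∈ L u ∨ (Wd u (f u) ∧ ∀ w, f w = f u → w = u)) with hA
  have hmA : ∀ f, f ∈ A ↔ (∀ v, f v ∈ pot L) ∧ (∀ u v, f u = f v → p u = p v) ∧
      ∀ u, f u ∈ L u ∨ (Wd u (f u) ∧ ∀ w, f w = f u → w = u) := by
    intro f
    rw [hA, Finset.mem_filter, Fintype.mem_piFinset]
  set μ : (V → ℕ) → ℕ := fun f => (Finset.univ.image f).card * (Fintype.card V + 1) +
    (Finset.univ.filter (fun v => M (f v) = v)).card with hμ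
  obtain ⟨f, hfA, hmax⟩ := A.exists_max_image μ ⟨f, (hmA f).2 ⟨hfC, hp, hacc⟩⟩
  obtain ⟨hfC, hp, hacc⟩ := (hmA f).1 hfA
  refine ⟨f, hfC, hp, hacc, ?_⟩
  by_contra! hno
  obtain ⟨c, hc, hcu⟩ := hno
  set v := M c with hv
  set f' := Function.update f v c with hf'
  have hf'v : f' v = c := by simp [hf']
  have hf'u : ∀ u, u ≠ v → f' u = f u := fun u hu => by simp [hf', hu]
  have hne : ∀ u, u ≠ v → f' u ≠ c := fun u hu => by rw [hf'u u hu]; exact hcu u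
  have hf'A : f' ∈ A := by
    rw [hmA]
    refine ⟨fun u => ?_, fun u w huw => ?_, fun u => ?_⟩
    · by_cases hu : u = v
      · rw [hu, hf'v]; exact hc
      · rw [hf'u u hu]; exact hfC u
    · by_cases hu : u = v <;> by_cases hw : w = v
      · rw [hu, hw]
      · rw [hu, hf'v] at huw
        exact absurd huw.symm (hne w hw)
      · rw [hw, hf'v] at huw
        exact absurd huw (hne u hu)
      · rw [hf'u u hu, hf'u w hw] at huw
        exact hp u w huw
    · by_cases hu : u = v
      · rw [hu, hf'v]; exact Or.inl (hM c hc)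
      · rw [hf'u u hu]
        refine (hacc u).imp id fun hw => ⟨hw.1, fun w hwu => ?_⟩
        by_cases hwv : w = v
        · rw [hwv, hf'v] at hwu
          exact absurd hwu.symm (hcu u)
        · rw [hf'u w hwv] at hwu
          exact hw.2 w hwu
  have hlt : μ f < μ f' := by
    have hb : ∀ g : V → ℕ, (Finset.univ.filter (fun v => M (g v) = v)).card ≤ Fintype.card V :=
      fun g => Finset.card_le_univ _
    by_cases hs : ∃ w, w ≠ v ∧ f w = f v
    · obtain ⟨w, hwv, hfw⟩ := hs
      have h1 : insert c (Finset.univ.image f) ⊆ Finset.univ.image f' := by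
        intro x hx
        rcases Finset.mem_insert.1 hx with rfl | hx
        · exact Finset.mem_image.2 ⟨v, Finset.mem_univ _, hf'v⟩
        · obtain ⟨u, _, rfl⟩ := Finset.mem_image.1 hx
          by_cases hu : u = v
          · exact Finset.mem_image.2 ⟨w, Finset.mem_univ _, by rw [hf'u w hwv, hfw, hu]⟩
          · exact Finset.mem_image.2 ⟨u, Finset.mem_univ _, hf'u u hu⟩
      have h2 := Finset.card_le_card h1
      rw [Finset.card_insert_of_notMem (by simpa using hcu)] at h2
      have h3 := hb f
      simp only [hμ]
      nlinarith
    · push Not at hs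
      have h1 : insert c ((Finset.univ.image f).erase (f v)) ⊆ Finset.univ.image f' := by
        intro x hx
        rcases Finset.mem_insert.1 hx with rfl | hx
        · exact Finset.mem_image.2 ⟨v, Finset.mem_univ _, hf'v⟩
        · obtain ⟨hx1, hx2⟩ := Finset.mem_erase.1 hx
          obtain ⟨u, _, rfl⟩ := Finset.mem_image.1 hx2
          have hu : u ≠ v := fun hu => hx1 (by rw [hu])
          exact Finset.mem_image.2 ⟨u, Finset.mem_univ _, hf'u u hu⟩
      have h2 := Finset.card_le_card h1
      rw [Finset.card_insert_of_notMem (fun hx => by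
          obtain ⟨u, _, hu⟩ := Finset.mem_image.1 (Finset.mem_of_mem_erase hx)
          exact hcu u hu),
        Finset.card_erase_of_mem (Finset.mem_image_of_mem _ (Finset.mem_univ _))] at h2
      have h3 : 0 < (Finset.univ.image f).card :=
        Finset.card_pos.2 ⟨f v, Finset.mem_image_of_mem _ (Finset.mem_univ _)⟩
      have h4 : (Finset.univ.filter (fun v => M (f v) = v)).card <
          (Finset.univ.filter (fun v => M (f' v) = v)).card := by
        apply Finset.card_lt_card
        refine ⟨fun u hu => ?_, fun hsub => ?_⟩
        · rw [Finset.mem_filter] at hu ⊢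
          refine ⟨Finset.mem_univ _, ?_⟩
          by_cases huv : u = v
          · rw [huv, hf'v]
          · rw [hf'u u huv]; exact hu.2
        · have : v ∈ Finset.univ.filter (fun v => M (f v) = v) :=
            hsub (Finset.mem_filter.2 ⟨Finset.mem_univ _, by rw [hf'v]⟩)
          have h5 := (Finset.mem_filter.1 this).2
          exact hcu v (hMinj _ (hfC v) _ hc (h5.trans hv))
      have h6 : (Finset.univ.image f).card ≤ (Finset.univ.image f').card := by omega
      simp only [hμ]
      nlinarith
  exact absurd (hmax f' hf'A) (not_le.2 hlt)

/-- If every wild vertex of a proper colouring forms a class on its own, then Hall's condition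
fails for the colour classes, and the failure has the structure described here. -/
theorem obstruction (h : CriticalList p k L) (Wd : V → ℕ → Prop) (f : V → ℕ)
    (hfC : ∀ v, f v ∈ pot L) (hp : ∀ u v, f u = f v → p u = p v)
    (hacc : ∀ u, f u ∈ L u ∨ (Wd u (f u) ∧ ∀ w, f w = f u → w = u)) :
    ∃ (X : Finset V) (K : Finset ℕ) (s : ℕ) (v : V) (c : ℕ), Wd v c ∧ v ∈ X ∧ c ∉ K ∧
      (∀ u ∈ X, L u ⊆ K) ∧ s + (pot L).card ≤ Fintype.card V ∧ k < (X.image p).card + s ∧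
      K.card + 1 ≤ X.card + s ∧
      ∀ c, c ∉ K → X.card + s ≤ (Finset.univ.filter (fun u => c ∉ L u)).card := by
  classical
  obtain ⟨f, hfC, hp, hacc, hsurj⟩ := h.exists_surjective Wd f hfC hp hacc
  set Lc : ℕ → Finset ℕ := fun c => (pot L).filter (fun d => ∀ v, f v = c → d ∈ L v) with hLc
  have hmLc : ∀ c d, d ∈ Lc c ↔ d ∈ pot L ∧ ∀ v, f v = c → d ∈ L v := by
    intro c d; rw [hLc, Finset.mem_filter]
  obtain ⟨S, hS, hSmax⟩ := ((pot L).powerset).exists_max_image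
    (fun S => S.card + ((pot L).card - (S.biUnion Lc).card)) ⟨∅, by simp⟩
  rw [Finset.mem_powerset] at hS
  have hbi : ∀ D : Finset ℕ, (D.biUnion Lc).card ≤ (pot L).card := fun D =>
    Finset.card_le_card (Finset.biUnion_subset.2 fun c _ => Finset.filter_subset _ _)
  set K := S.biUnion Lc with hK
  have hlt : K.card < S.card := by
    by_contra hge
    obtain ⟨g, hg, hinj⟩ := exists_injOn_of_hall (pot L) Lc (fun D hD => by
      have h1 := hSmax D (Finset.mem_powerset.2 hD)
      have : K.card ≤ (pot L).card := hbi S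
      have := hbi D
      omega)
    refine h.not_col' (fun v => g (f v)) (fun v => ?_) fun u v huv => ?_
    · exact ((hmLc _ _).1 (hg _ (hfC v))).2 v rfl
    · exact hp u v (hinj _ (hfC u) _ (hfC v) huv)
  obtain ⟨g, hg, hginj⟩ := exists_injOn_of_hall (pot L \ S) (fun c => Lc c \ K) (fun D hD => by
    have hdisj : Disjoint S D := by
      rw [Finset.disjoint_left]
      intro x hx hxD
      exact (Finset.mem_sdiff.1 (hD hxD)).2 hx
    have h1 := hSmax (S ∪ D) (Finset.mem_powerset.2
      (Finset.union_subset hS (hD.trans Finset.sdiff_subset)))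
    have h2 : ((S ∪ D).biUnion Lc) ⊆ K ∪ D.biUnion (fun c => Lc c \ K) := by
      intro x hx
      obtain ⟨c, hc, hxc⟩ := Finset.mem_biUnion.1 hx
      rw [Finset.mem_union]
      by_cases hxK : x ∈ K
      · exact Or.inl hxK
      · rcases Finset.mem_union.1 hc with hc | hc
        · exact absurd (Finset.mem_biUnion.2 ⟨c, hc, hxc⟩) hxK
        · exact Or.inr (Finset.mem_biUnion.2 ⟨c, hc, Finset.mem_sdiff.2 ⟨hxc, hxK⟩⟩)
    have h3 := (Finset.card_le_card h2).trans (Finset.card_union_le _ _)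
    rw [Finset.card_union_of_disjoint hdisj] at h1
    have : K.card ≤ (pot L).card := hbi S
    have := hbi (S ∪ D)
    omega)
  set cl : ℕ → Finset V := fun c => Finset.univ.filter (fun v => f v = c) with hcl
  have hmcl : ∀ c v, v ∈ cl c ↔ f v = c := by intro c v; simp [hcl]
  set S₁ := S.filter (fun c => (cl c).card = 1) with hS₁
  set S₂ := S.filter (fun c => ¬ (cl c).card = 1) with hS₂
  have hS12 : S₁.card + S₂.card = S.card := Finset.card_filter_add_card_filter_not _
  have hclpos : ∀ c ∈ pot L, 0 < (cl c).card := fun c hc => by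
    obtain ⟨v, hv⟩ := hsurj c hc
    exact Finset.card_pos.2 ⟨v, (hmcl _ _).2 hv⟩
  have hn : Fintype.card V = ∑ c ∈ pot L, (cl c).card := by
    rw [← Finset.card_univ]
    exact Finset.card_eq_sum_card_fiberwise fun v _ => hfC v
  have hsn : S₂.card + (pot L).card ≤ Fintype.card V := by
    have h1 : ∑ c ∈ pot L, (1 + if c ∈ S₂ then 1 else 0) ≤ ∑ c ∈ pot L, (cl c).card := by
      refine Finset.sum_le_sum fun c hc => ?_
      have := hclpos c hc
      split_ifs with h2
      · have := (Finset.mem_filter.1 h2).2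
        omega
      · omega
    have hsub : S₂ ⊆ pot L := (Finset.filter_subset _ _).trans hS
    rw [Finset.sum_add_distrib, ← Finset.card_eq_sum_ones, ← Finset.sum_filter,
      ← Finset.card_eq_sum_ones, Finset.filter_mem_eq_inter,
      Finset.inter_eq_right.2 hsub] at h1
    omega
  set X : Finset V := Finset.univ.filter (fun v => f v ∈ S₁) with hX
  have hmX : ∀ v, v ∈ X ↔ f v ∈ S₁ := by intro v; simp [hX]
  have hXs : ∀ u ∈ X, ∀ w, f w = f u → w = u := fun u hu w hw => by
    have h1 := (Finset.mem_filter.1 ((hmX u).1 hu)).2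
    obtain ⟨a, ha⟩ := Finset.card_eq_one.1 h1
    have h2 : w ∈ cl (f u) := (hmcl _ _).2 hw
    have h3 : u ∈ cl (f u) := (hmcl _ _).2 rfl
    rw [ha, Finset.mem_singleton] at h2 h3
    rw [h2, h3]
  have hXcard : X.card = S₁.card := by
    refine Finset.card_bij (fun v _ => f v) (fun v hv => (hmX v).1 hv)
      (fun u hu v hv huv => hXs v hv u huv) fun c hc => ?_
    obtain ⟨v, hv⟩ := hsurj c (hS (Finset.mem_filter.1 hc).1)
    exact ⟨v, (hmX v).2 (by rwa [hv]), hv⟩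
  have hXK : ∀ u ∈ X, L u ⊆ K := fun u hu d hd =>
    Finset.mem_biUnion.2 ⟨f u, (Finset.mem_filter.1 ((hmX u).1 hu)).1,
      (hmLc _ _).2 ⟨mem_pot.2 ⟨u, hd⟩, fun w hw => by rwa [hXs u hu w hw]⟩⟩
  have hSacc : ∀ u, f u ∈ S₂ → f u ∈ L u := fun u hu => by
    rcases hacc u with h1 | ⟨_, h2⟩
    · exact h1
    · refine absurd (Finset.card_eq_one.2 ⟨u, ?_⟩) (Finset.mem_filter.1 hu).2
      ext w
      rw [hmcl, Finset.mem_singleton]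
      exact ⟨fun hw => h2 w hw, fun hw => by rw [hw]⟩
  have hS₂K : ∀ c ∈ S₂, c ∈ K := fun c hc => by
    refine Finset.mem_biUnion.2 ⟨c, (Finset.mem_filter.1 hc).1, (hmLc _ _).2
      ⟨hS (Finset.mem_filter.1 hc).1, ?_⟩⟩
    rintro v rfl
    exact hSacc v hc
  obtain ⟨c, hcS, hcK⟩ := Finset.exists_mem_notMem_of_card_lt_card hlt
  obtain ⟨v, hvc, hvL⟩ : ∃ v, f v = c ∧ f v ∉ L v := by
    by_contra! hcon
    exact hcK (Finset.mem_biUnion.2 ⟨c, hcS, (hmLc _ _).2 ⟨hS hcS, fun v hv => by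
      rw [← hv]; exact hcon v hv⟩⟩)
  have hvW := (hacc v).resolve_left hvL
  have hvX : v ∈ X := by
    rw [hmX, hS₁, Finset.mem_filter, hvc]
    refine ⟨hcS, Finset.card_eq_one.2 ⟨v, ?_⟩⟩
    ext w
    rw [hmcl, Finset.mem_singleton, ← hvc]
    exact ⟨fun hw => hvW.2 w hw, fun hw => by rw [hw]⟩
  refine ⟨X, K, S₂.card, v, c, hvc ▸ hvW.1, hvX, hcK, hXK, hsn, ?_, by omega, ?_⟩
  · by_contra hle
    have hpot := h.card_pot_lt
    have hSc := Finset.card_le_card hS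
    have hnk := h.card_le
    obtain ⟨e, he, hep⟩ := h.ih X (k - S₂.card) (fun v => L v \ S₂) (by omega) (by omega)
      (by omega) (fun v _ => by
        have := Finset.le_card_sdiff S₂ (L v)
        have := h.le_card v
        omega)
    refine h.not_col' (fun v => if f v ∈ S₁ then e v else if f v ∈ S₂ then f v else g (f v))
      (fun v => ?_) fun u v huv => ?_
    · by_cases h1 : f v ∈ S₁
      · simp only [h1, if_true]
        exact (Finset.mem_sdiff.1 (he v ((hmX v).2 h1))).1
      · by_cases h2 : f v ∈ S₂
        · simp only [h1, h2, if_true, if_false]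
          exact hSacc v h2
        · simp only [h1, h2, if_false]
          have hvS : f v ∈ pot L \ S := by
            refine Finset.mem_sdiff.2 ⟨hfC v, fun hfS => ?_⟩
            by_cases h3 : (cl (f v)).card = 1
            · exact h1 (Finset.mem_filter.2 ⟨hfS, h3⟩)
            · exact h2 (Finset.mem_filter.2 ⟨hfS, h3⟩)
          exact ((hmLc _ _).1 (Finset.mem_sdiff.1 (hg _ hvS)).1).2 v rfl
    · have key1 : ∀ v, f v ∈ S₁ → e v ∈ K ∧ e v ∉ S₂ := fun v hv =>
        ⟨hXK v ((hmX v).2 hv) (Finset.mem_sdiff.1 (he v ((hmX v).2 hv))).1,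
          (Finset.mem_sdiff.1 (he v ((hmX v).2 hv))).2⟩
      have key3 : ∀ v, f v ∉ S₁ → f v ∉ S₂ → f v ∈ pot L \ S := fun v h1 h2 => by
        refine Finset.mem_sdiff.2 ⟨hfC v, fun hfS => ?_⟩
        by_cases h3 : (cl (f v)).card = 1
        · exact h1 (Finset.mem_filter.2 ⟨hfS, h3⟩)
        · exact h2 (Finset.mem_filter.2 ⟨hfS, h3⟩)
      have key4 : ∀ v, f v ∉ S₁ → f v ∉ S₂ → g (f v) ∉ K := fun v h1 h2 =>
        (Finset.mem_sdiff.1 (hg _ (key3 v h1 h2))).2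
      by_cases hu1 : f u ∈ S₁ <;> by_cases hv1 : f v ∈ S₁
      · simp only [hu1, hv1, if_true] at huv
        exact hep u ((hmX u).2 hu1) v ((hmX v).2 hv1) huv
      · by_cases hv2 : f v ∈ S₂
        · simp only [hu1, hv1, hv2, if_true, if_false] at huv
          exact absurd (huv ▸ hv2) (key1 u hu1).2
        · simp only [hu1, hv1, hv2, if_true, if_false] at huv
          exact absurd (huv ▸ (key1 u hu1).1) (key4 v hv1 hv2)
      · by_cases hu2 : f u ∈ S₂
        · simp only [hu1, hv1, hu2, if_true, if_false] at huv
          exact absurd (huv ▸ hu2) (key1 v hv1).2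
        · simp only [hu1, hv1, hu2, if_true, if_false] at huv
          exact absurd (huv ▸ (key1 v hv1).1) (key4 u hu1 hu2)
      · by_cases hu2 : f u ∈ S₂ <;> by_cases hv2 : f v ∈ S₂
        · simp only [hu1, hv1, hu2, hv2, if_true, if_false] at huv
          exact hp u v huv
        · simp only [hu1, hv1, hu2, hv2, if_true, if_false] at huv
          exact absurd (huv ▸ hS₂K _ hu2) (key4 v hv1 hv2)
        · simp only [hu1, hv1, hu2, hv2, if_true, if_false] at huv
          exact absurd (huv ▸ hS₂K _ hv2) (key4 u hu1 hu2)
        · simp only [hu1, hv1, hu2, hv2, if_false] at huv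
          exact hp u v (hginj _ (key3 u hu1 hu2) _ (key3 v hv1 hv2) huv)
  · intro d hd
    have := h.nonempty
    have hmiss : ∀ c ∈ S₂, ∃ u, f u = c ∧ d ∉ L u := fun c hc => by
      by_contra! hcon
      obtain ⟨w, hw⟩ := hsurj c (hS (Finset.mem_filter.1 hc).1)
      exact hd (Finset.mem_biUnion.2 ⟨c, (Finset.mem_filter.1 hc).1,
        (hmLc _ _).2 ⟨mem_pot.2 ⟨w, hcon w hw⟩, hcon⟩⟩)
    choose! r hr hrd using hmiss
    have hrimg : (S₂.image r).card = S₂.card := Finset.card_image_of_injOn fun a ha b hb hab => by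
      rw [← hr a ha, ← hr b hb, hab]
    rw [← hrimg, ← Finset.card_union_of_disjoint]
    · apply Finset.card_le_card
      intro u hu
      rw [Finset.mem_filter]
      refine ⟨Finset.mem_univ _, ?_⟩
      rcases Finset.mem_union.1 hu with hu | hu
      · exact fun hdu => hd (hXK u hu hdu)
      · obtain ⟨c, hc, rfl⟩ := Finset.mem_image.1 hu
        exact hrd c hc
    · rw [Finset.disjoint_left]
      intro u hu hu'
      obtain ⟨c, hc, rfl⟩ := Finset.mem_image.1 hu'
      have h1 := (Finset.mem_filter.1 ((hmX _).1 hu)).2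
      rw [hr c hc] at h1
      exact (Finset.mem_filter.1 hc).2 h1

end CriticalList

/-- The vertices whose list contains the colour `c`. -/
def occ (L : V → Finset ℕ) (c : ℕ) : Finset V := Finset.univ.filter (fun v => c ∈ L v)

/-- The colours in many lists, or in the lists of many singleton parts. -/
def frequent (p : V → ℕ) (k : ℕ) (L : V → Finset ℕ) : Finset ℕ :=
  (pot L).filter (fun c => k + 1 ≤ (occ L c).card ∨
    Fintype.card V ≤ (pot L).card + (singles p ∩ occ L c).card)

@[simp] theorem mem_occ {L : V → Finset ℕ} {c : ℕ} {v : V} : v ∈ occ L c ↔ c ∈ L v := by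
  simp [occ]

theorem card_occ_add_card_notMem (L : V → Finset ℕ) (c : ℕ) :
    (occ L c).card + (Finset.univ.filter (fun u => c ∉ L u)).card = Fintype.card V :=
  (Finset.card_filter_add_card_filter_not _).trans Finset.card_univ

theorem frequent_subset {p : V → ℕ} {k : ℕ} {L : V → Finset ℕ} : frequent p k L ⊆ pot L :=
  Finset.filter_subset _ _

/-- The parts that avoid `X` and consist of a single vertex reduce the number of labels in `X`. -/
theorem card_image_add_card_singles_sdiff_le (p : V → ℕ) (X : Finset V) :
    (X.image p).card + (singles p \ X).card ≤ (Finset.univ.image p).card := by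
  have h1 : ((singles p \ X).image p).card = (singles p \ X).card :=
    Finset.card_image_of_injOn fun u _ v hv huv =>
      mem_singles.1 (Finset.mem_sdiff.1 hv).1 u huv
  rw [← h1, ← Finset.card_union_of_disjoint]
  · exact Finset.card_le_card (Finset.union_subset (Finset.image_subset_image
      (Finset.subset_univ _)) (Finset.image_subset_image (Finset.subset_univ _)))
  · rw [Finset.disjoint_left]
    intro a ha hb
    obtain ⟨u, hu, rfl⟩ := Finset.mem_image.1 ha
    obtain ⟨v, hv, huv⟩ := Finset.mem_image.1 hb
    have := mem_singles.1 (Finset.mem_sdiff.1 hv).1 u huv.symm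
    exact (Finset.mem_sdiff.1 hv).2 (this ▸ hu)

theorem sum_card_inter_eq (L : V → Finset ℕ) (A : Finset V) (D : Finset ℕ) :
    ∑ v ∈ A, (L v ∩ D).card = ∑ c ∈ D, (A ∩ occ L c).card := by
  have h := Finset.sum_card_bipartiteAbove_eq_sum_card_bipartiteBelow
    (s := A) (t := D) (fun v c => c ∈ L v)
  have h1 : ∀ v, (L v ∩ D) = Finset.bipartiteAbove (fun v c => c ∈ L v) D v := by
    intro v; ext c; simp [Finset.bipartiteAbove, and_comm]
  have h2 : ∀ c, (A ∩ occ L c) = Finset.bipartiteBelow (fun v c => c ∈ L v) A c := by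
    intro v; ext c; simp [Finset.bipartiteBelow]
  simp only [h1, h2]
  exact h

namespace CriticalList
variable {p : V → ℕ} {k : ℕ} {L : V → Finset ℕ}

theorem frequent_subset_of_obstruction (h : CriticalList p k L) {X : Finset V} {K : Finset ℕ}
    {s : ℕ} {v : V} (hv : v ∈ X) (hXK : ∀ u ∈ X, L u ⊆ K)
    (hs : s + (pot L).card ≤ Fintype.card V) (hk : k < (X.image p).card + s)
    (hKX : K.card + 1 ≤ X.card + s)
    (hmiss : ∀ c, c ∉ K → X.card + s ≤ (Finset.univ.filter (fun u => c ∉ L u)).card) :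
    frequent p k L ⊆ K := by
  intro c hc
  by_contra hcK
  have h1 := hmiss c hcK
  have h2 := (h.le_card v).trans (Finset.card_le_card (hXK v hv))
  have h3 := card_occ_add_card_notMem L c
  have h4 := h.card_le
  rcases (Finset.mem_filter.1 hc).2 with h5 | h5
  · omega
  · have h6 := card_image_add_card_singles_sdiff_le p X
    rw [h.card_image] at h6
    have h7 : singles p ∩ occ L c ⊆ singles p \ X := by
      intro u hu
      rw [Finset.mem_inter, mem_occ] at hu
      exact Finset.mem_sdiff.2 ⟨hu.1, fun huX => hcK (hXK u huX hu.2)⟩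
    have := Finset.card_le_card h7
    omega

/-- There is no proper colouring in which every vertex receives a colour of its list or is the only
vertex coloured by some frequent colour. -/
theorem not_nearAcceptable (h : CriticalList p k L) (f : V → ℕ)
    (hp : ∀ u v, f u = f v → p u = p v)
    (hacc : ∀ u, f u ∈ L u ∨ (f u ∈ frequent p k L ∧ ∀ w, f w = f u → w = u)) : False := by
  obtain ⟨X, K, s, v, c, hc, hv, hcK, hXK, hs, hk, hKX, hmiss⟩ :=
    h.obstruction (fun _ x => x ∈ frequent p k L) f (fun v => by
      rcases hacc v with h1 | h1
      · exact mem_pot.2 ⟨v, h1⟩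
      · exact frequent_subset h1.1) hp hacc
  exact hcK (h.frequent_subset_of_obstruction hv hXK hs hk hKX hmiss hc)

theorem card_eq (h : CriticalList p k L) : (singles p).card + (bigLabels p).card = k := by
  rw [card_singles_add_card_bigLabels, h.card_image]

theorem card_occ_le (h : CriticalList p k L) (c : ℕ) :
    (occ L c).card ≤ k + (singles p).card + 1 := by
  have := h.nonempty
  have h1 : ∀ a ∈ bigLabels p, ∃ v, p v = a ∧ c ∉ L v := fun a ha => h.exists_notMem ha c
  choose! r hr hrc using h1
  have h2 : ((bigLabels p).image r).card = (bigLabels p).card :=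
    Finset.card_image_of_injOn fun a ha b hb hab => by
      rw [← hr a ha, ← hr b hb, hab]
  have h3 : (bigLabels p).image r ⊆ Finset.univ.filter (fun u => c ∉ L u) := by
    intro u hu
    obtain ⟨a, ha, rfl⟩ := Finset.mem_image.1 hu
    exact Finset.mem_filter.2 ⟨Finset.mem_univ _, hrc a ha⟩
  have h4 := Finset.card_le_card h3
  have h5 := card_occ_add_card_notMem L c
  have h6 := h.card_le
  have h7 := h.card_eq
  omega

theorem mul_card_le_sum_occ (h : CriticalList p k L) :
    k * Fintype.card V ≤ ∑ c ∈ pot L, (occ L c).card := by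
  have h1 := sum_card_inter_eq L Finset.univ (pot L)
  simp only [Finset.univ_inter] at h1
  rw [← h1]
  calc k * Fintype.card V = ∑ v : V, k := by simp [mul_comm]
    _ ≤ _ := Finset.sum_le_sum fun v _ => by
      rw [Finset.inter_eq_left.2 (fun c hc => mem_pot.2 ⟨v, hc⟩)]
      exact h.le_card v

theorem card_occ_le_of_notMem {c : ℕ} (hc : c ∉ frequent p k L) (hcp : c ∈ pot L) :
    (occ L c).card ≤ k ∧ (pot L).card + (singles p ∩ occ L c).card < Fintype.card V := by
  by_contra hcon
  refine hc (Finset.mem_filter.2 ⟨hcp, ?_⟩)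
  by_contra hcon'
  omega

theorem mul_card_le (h : CriticalList p k L) :
    k * Fintype.card V ≤ (frequent p k L).card * ((singles p).card + 1) + (pot L).card * k := by
  refine h.mul_card_le_sum_occ.trans ?_
  have h1 : ∀ c ∈ pot L, (occ L c).card ≤
      k + if c ∈ frequent p k L then (singles p).card + 1 else 0 := fun c hc => by
    split_ifs with hF
    · have := h.card_occ_le c
      omega
    · exact (card_occ_le_of_notMem hF hc).1
  refine (Finset.sum_le_sum h1).trans ?_
  rw [Finset.sum_add_distrib, ← Finset.sum_filter, Finset.filter_mem_eq_inter,
    Finset.inter_eq_right.2 frequent_subset, Finset.sum_const, Finset.sum_const, smul_eq_mul,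
    smul_eq_mul, add_comm]

end CriticalList

theorem frequent_arith {k t b γ φ N σ κ x : ℤ} (hk : k = t + b) (hφ : φ + 1 ≤ b) (hφ0 : 0 ≤ φ)
    (hb : b ≤ t + 1) (hγt : 2 * γ ≤ t) (hγ : 2 ≤ γ) (hN : N = 2 * k + 1 - γ - φ)
    (hσ : k * (2 * k + 1) ≤ φ * (k + t + 1) + N * σ) (hx : t + 1 ≤ x + γ)
    (hcount : (k - φ) * x ≤ (γ - 1) * (κ - φ)) (hκ : κ ≤ 2 * k - σ) : False := by
  have hd : t + 1 ≤ k - φ := by linarith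
  have hN' : γ ≤ N := by linarith
  have h1 : (k - φ) * (t + 1 - γ) ≤ (γ - 1) * (2 * k - σ - φ) := by
    have h2 : (k - φ) * (t + 1 - γ) ≤ (k - φ) * x := by
      apply mul_le_mul_of_nonneg_left <;> linarith
    have h3 : (γ - 1) * (κ - φ) ≤ (γ - 1) * (2 * k - σ - φ) := by
      apply mul_le_mul_of_nonneg_left <;> linarith
    linarith
  have h4 : N * (2 * k - σ - φ) ≤ N * (k - φ) + (φ * (t + 1) - k * γ) := by
    subst hN; linarith
  have h5 : N * ((k - φ) * (t + 1 - γ)) ≤ N * ((γ - 1) * (2 * k - σ - φ)) :=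
    mul_le_mul_of_nonneg_left h1 (by linarith)
  have h6 : (γ - 1) * (N * (2 * k - σ - φ)) ≤
      (γ - 1) * (N * (k - φ) + (φ * (t + 1) - k * γ)) :=
    mul_le_mul_of_nonneg_left h4 (by linarith)
  have h7 : φ * (t + 1) - k * γ ≤ (t + 1) * (t + 1 - 2 * γ) := by
    have h8 : φ * (t + 1) ≤ (b - 1) * (t + 1) := mul_le_mul_of_nonneg_right (by linarith)
      (by linarith)
    have h9 : (b - (t + 1)) * (t + 1 - γ) ≤ 0 :=
      mul_nonpos_of_nonpos_of_nonneg (by linarith) (by linarith)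
    subst hk
    linarith
  have h10 : (γ - 1) * (φ * (t + 1) - k * γ) ≤ (γ - 1) * ((t + 1) * (t + 1 - 2 * γ)) :=
    mul_le_mul_of_nonneg_left h7 (by linarith)
  have h11 : γ * (t + 1) ≤ N * (k - φ) :=
    mul_le_mul hN' hd (by linarith) (by linarith)
  have h12 : γ * (t + 1) * (t + 2 - 2 * γ) ≤ N * (k - φ) * (t + 2 - 2 * γ) :=
    mul_le_mul_of_nonneg_right h11 (by linarith)
  have h13 : 0 < (t + 1) * (t + 1 - 2 * γ + γ) := mul_pos (by linarith) (by linarith)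
  linarith

namespace CriticalList
variable {p : V → ℕ} {k : ℕ} {L : V → Finset ℕ}

theorem card_bigLabels_le_frequent (h : CriticalList p k L) :
    (bigLabels p).card ≤ (frequent p k L).card := by
  by_contra! hlt
  have hkt := h.card_eq
  have hcount := h.mul_card_le
  have hpot := h.card_pot_lt
  have hnk := h.card_le
  obtain ⟨γ, hγ⟩ := Nat.exists_eq_add_of_le hpot.le
  have hcount' : k * γ ≤ (frequent p k L).card * ((singles p).card + 1) := by
    rw [hγ] at hcount; nlinarith
  set t := (singles p).card with ht
  set b := (bigLabels p).card with hb
  set φ := (frequent p k L).card with hφ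
  have hcount2 : (t + b) * γ + (t + 1) ≤ b * (t + 1) := by
    have : (φ + 1) * (t + 1) ≤ b * (t + 1) := Nat.mul_le_mul_right _ hlt
    rw [hkt]
    linarith
  have hγt : γ ≤ t := by
    by_contra! hcon
    have : (t + b) * (t + 1) ≤ (t + b) * γ := Nat.mul_le_mul_left _ hcon
    nlinarith
  have hγ2 : 2 ≤ γ := by
    by_contra! hcon
    have hγ1 : γ = 1 := by omega
    obtain ⟨v, hv⟩ := Finset.card_pos.1 (show 0 < (singles p).card by omega)
    have hsub : L v ⊆ frequent p k L := fun c hc => by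
      refine Finset.mem_filter.2 ⟨mem_pot.2 ⟨v, hc⟩, Or.inr ?_⟩
      have : 0 < (singles p ∩ occ L c).card :=
        Finset.card_pos.2 ⟨v, Finset.mem_inter.2 ⟨hv, mem_occ.2 hc⟩⟩
      omega
    have := (h.le_card v).trans (Finset.card_le_card hsub)
    omega
  obtain ⟨v₁, hv₁⟩ := Finset.card_pos.1 (show 0 < (singles p).card by omega)
  have hn := h.card_eq_of_single hv₁
  have hpart : ∀ a ∈ bigLabels p, 3 ≤ (part p a).card := fun a ha => by
    by_contra! hcon
    have h2 : (part p a).card = 2 := by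
      have := mem_bigLabels.1 ha
      omega
    obtain ⟨u, w, huw, hpa⟩ := Finset.card_eq_two.1 h2
    have hdisj : Disjoint (L u) (L w) := by
      rw [Finset.disjoint_left]
      intro c hcu hcw
      obtain ⟨v, hv, hcv⟩ := h.exists_notMem ha c
      rw [← mem_part, hpa, Finset.mem_insert, Finset.mem_singleton] at hv
      rcases hv with rfl | rfl
      · exact hcv hcu
      · exact hcv hcw
    have hsub : L u ∪ L w ⊆ pot L := Finset.union_subset (fun c hc => mem_pot.2 ⟨u, hc⟩)
      fun c hc => mem_pot.2 ⟨w, hc⟩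
    have h3 := Finset.card_le_card hsub
    rw [Finset.card_union_of_disjoint hdisj] at h3
    have := h.le_card u
    have := h.le_card w
    omega
  have hbt : b ≤ t + 1 := by
    have h1 := card_eq_sum_parts p
    have h2 := Finset.card_nsmul_le_sum _ _ _ hpart
    rw [smul_eq_mul] at h2
    omega
  have hγ2t : 2 * γ ≤ t := by
    by_contra! hcon
    have : (t + b) * (t + 1) ≤ (t + b) * (2 * γ) := Nat.mul_le_mul_left _ hcon
    nlinarith
  have hF := frequent_subset (p := p) (k := k) (L := L)
  have hkC : k ≤ (pot L).card := (h.le_card v₁).trans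
    (Finset.card_le_card fun c hc => mem_pot.2 ⟨v₁, hc⟩)
  have hNc : (pot L \ frequent p k L).card + φ = (pot L).card :=
    Finset.card_sdiff_add_card_eq_card hF
  obtain ⟨c, hcN, hcmax⟩ := (pot L \ frequent p k L).exists_max_image
    (fun c => (occ L c).card) (Finset.card_pos.1 (by omega))
  obtain ⟨hcp, hcF⟩ := Finset.mem_sdiff.1 hcN
  have hτ := (card_occ_le_of_notMem hcF hcp).2
  obtain ⟨v, hv, hcv⟩ : ∃ v ∈ singles p, c ∉ L v := by
    by_contra! hcon
    have : singles p ∩ occ L c = singles p :=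
      Finset.inter_eq_left.2 fun v hv => mem_occ.2 (hcon v hv)
    rw [this] at hτ
    omega
  obtain ⟨f, hf, hp⟩ := h.maximal v c hcp hcv
  have hfu : ∀ u, u ≠ v → f u ∈ L u := fun u hu => by
    have := hf u (Finset.mem_univ _)
    rwa [Function.update_of_ne hu] at this
  have hfv : f v = c := by
    have := hf v (Finset.mem_univ _)
    rw [Function.update_self] at this
    rcases Finset.mem_insert.1 this with h1 | h1
    · exact h1
    · refine (h.not_col' f (fun u => ?_) fun u w => hp u (Finset.mem_univ _) w
        (Finset.mem_univ _)).elim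
      by_cases hu : u = v
      · rw [hu]; exact h1
      · exact hfu u hu
  obtain ⟨X, K, s, v', c', ⟨rfl, rfl⟩, hvX, hcK, hXK, hs, hk, hKX, hmiss⟩ :=
    h.obstruction (fun u x => u = v ∧ x = c) f (fun u => by
      by_cases hu : u = v
      · rw [hu, hfv]; exact hcp
      · exact mem_pot.2 ⟨u, hfu u hu⟩)
      (fun u w => hp u (Finset.mem_univ _) w (Finset.mem_univ _)) (fun u => by
      by_cases hu : u = v
      · subst hu
        exact Or.inr ⟨⟨rfl, hfv⟩, fun w hw => mem_singles.1 hv w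
          (hp w (Finset.mem_univ _) u (Finset.mem_univ _) hw)⟩
      · exact Or.inl (hfu u hu))
  have hFK := h.frequent_subset_of_obstruction hvX hXK hs hk hKX hmiss
  have hTX : t + 1 ≤ (singles p ∩ X).card + γ := by
    have h1 := card_image_add_card_singles_sdiff_le p X
    have h2 := Finset.card_sdiff_add_card_inter (singles p) X
    rw [h.card_image] at h1
    omega
  have hKF : (K \ frequent p k L).card + φ = K.card := Finset.card_sdiff_add_card_eq_card hFK
  have hdouble : (singles p ∩ X).card * (k - φ) ≤ (K \ frequent p k L).card * (γ - 1) := by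
    have h1 := sum_card_inter_eq L (singles p ∩ X) (K \ frequent p k L)
    have h2 : (singles p ∩ X).card * (k - φ) ≤
        ∑ v ∈ singles p ∩ X, (L v ∩ (K \ frequent p k L)).card := by
      rw [← smul_eq_mul]
      refine Finset.card_nsmul_le_sum _ _ _ fun u hu => ?_
      have h3 : L u \ frequent p k L ⊆ L u ∩ (K \ frequent p k L) := fun d hd => by
        obtain ⟨hd1, hd2⟩ := Finset.mem_sdiff.1 hd
        exact Finset.mem_inter.2 ⟨hd1, Finset.mem_sdiff.2
          ⟨hXK u (Finset.mem_inter.1 hu).2 hd1, hd2⟩⟩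
      have h4 := Finset.card_le_card h3
      have h5 := Finset.le_card_sdiff (frequent p k L) (L u)
      have := h.le_card u
      omega
    have h3 : ∑ d ∈ K \ frequent p k L, ((singles p ∩ X) ∩ occ L d).card ≤
        (K \ frequent p k L).card * (γ - 1) := by
      rw [← smul_eq_mul]
      refine Finset.sum_le_card_nsmul _ _ _ fun d hd => ?_
      have h4 : ((singles p ∩ X) ∩ occ L d) ⊆ singles p ∩ occ L d :=
        Finset.inter_subset_inter_right Finset.inter_subset_left
      have h5 := Finset.card_le_card h4
      by_cases hdp : d ∈ pot L
      · have := (card_occ_le_of_notMem (Finset.mem_sdiff.1 hd).2 hdp).2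
        omega
      · have : singles p ∩ occ L d = ∅ := by
          ext u
          simp only [Finset.mem_inter, mem_occ, Finset.notMem_empty, iff_false, not_and]
          exact fun _ hdu => hdp (mem_pot.2 ⟨u, hdu⟩)
        rw [this, Finset.card_empty] at h5
        omega
    omega
  have hsum : k * Fintype.card V ≤ φ * (k + t + 1) +
      (pot L \ frequent p k L).card * (occ L c').card := by
    refine h.mul_card_le_sum_occ.trans ?_
    rw [← Finset.sum_sdiff hF, add_comm]
    refine Nat.add_le_add ?_ ?_
    · rw [← smul_eq_mul]
      exact Finset.sum_le_card_nsmul _ _ _ fun d _ => h.card_occ_le d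
    · rw [← smul_eq_mul]
      exact Finset.sum_le_card_nsmul _ _ _ fun d hd => hcmax d hd
  have hmissc := hmiss c' hcK
  have hoccc := card_occ_add_card_notMem L c'
  refine frequent_arith (k := k) (t := t) (b := b) (γ := γ) (φ := φ)
    (N := (pot L \ frequent p k L).card) (σ := (occ L c').card) (κ := K.card)
    (x := (singles p ∩ X).card) (by omega) (by omega) (by omega) (by omega) (by omega) (by omega)
    (by omega) ?_ (by omega) ?_ (by omega)
  · rw [hn] at hsum
    exact_mod_cast hsum
  · have h1 : ((k - φ : ℕ) : ℤ) = (k : ℤ) - φ := by omega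
    have h2 : ((γ - 1 : ℕ) : ℤ) = (γ : ℤ) - 1 := by omega
    have h3 : ((K \ frequent p k L).card : ℤ) = (K.card : ℤ) - φ := by omega
    rw [← h1, ← h2, ← h3, mul_comm, mul_comm ((γ - 1 : ℕ) : ℤ)]
    exact_mod_cast hdouble

end CriticalList

/-- The vertices of `dom` coloured `c` by `g`. -/
def colourClass (dom : Finset V) (g : V → ℕ) (c : ℕ) : Finset V := dom.filter (fun v => g v = c)

@[simp] theorem mem_colourClass {dom : Finset V} {g : V → ℕ} {c : ℕ} {v : V} :
    v ∈ colourClass dom g c ↔ v ∈ dom ∧ g v = c := by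
  simp [colourClass]

/-- The partial colourings `g` of `dom` built by the greedy procedure, where `F` is the set of
colours that may be used on whole parts only. -/
structure GreedyState (p : V → ℕ) (L : V → Finset ℕ) (F : Finset ℕ) (dom : Finset V)
    (g : V → ℕ) : Prop where
  big : ∀ v ∈ dom, p v ∈ bigLabels p
  mem : ∀ v ∈ dom, g v ∈ L v
  proper : ∀ u ∈ dom, ∀ v ∈ dom, g u = g v → p u = p v
  card_le : ∀ v ∈ dom, g v ∉ F → ∀ a ∈ bigLabels p,
    ((part p a \ dom) ∩ occ L (g v)).card ≤ (colourClass dom g (g v)).card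
  two_le : ∀ v ∈ dom, g v ∈ F → 2 ≤ (colourClass dom g (g v)).card
  full : ∀ v ∈ dom, g v ∈ F → ∀ u, p u = p v → u ∈ dom
  unique : ∀ u ∈ dom, ∀ v ∈ dom, p u = p v → g u ∈ F → g v ∈ F → g u = g v

/-- `(dom', g')` extends `(dom, g)`. -/
def Extends (dom' : Finset V) (g' : V → ℕ) (dom : Finset V) (g : V → ℕ) : Prop :=
  dom ⊆ dom' ∧ ∀ v ∈ dom, g' v = g v

/-- A state of the greedy procedure that cannot be extended. -/
structure TerminalState (p : V → ℕ) (L : V → Finset ℕ) (F : Finset ℕ) (dom : Finset V)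
    (g : V → ℕ) : Prop extends GreedyState p L F dom g where
  card_le_card : ∀ (dom' : Finset V) (g' : V → ℕ), GreedyState p L F dom' g' →
    Extends dom' g' dom g → dom'.card ≤ dom.card

theorem greedyState_empty (p : V → ℕ) (L : V → Finset ℕ) (F : Finset ℕ) (g : V → ℕ) :
    GreedyState p L F ∅ g := by
  constructor <;> simp

namespace GreedyState
variable {p : V → ℕ} {L : V → Finset ℕ} {F : Finset ℕ} {dom : Finset V} {g : V → ℕ}

theorem extend (h : GreedyState p L F dom g) {W : Finset V} {a c : ℕ} (hW : W.Nonempty)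
    (hdisj : Disjoint W dom) (hWa : ∀ w ∈ W, p w = a) (ha : a ∈ bigLabels p)
    (hWc : ∀ w ∈ W, c ∈ L w) (hca : ∀ u ∈ dom, g u = c → p u = a)
    (hQ : c ∉ F → ∀ a' ∈ bigLabels p, ((part p a' \ dom) ∩ occ L c).card ≤
      (W ∪ colourClass dom g c).card)
    (hF : c ∈ F → (∀ u ∈ dom, g u ≠ c) ∧ 2 ≤ W.card ∧ ∀ u, p u = a → u ∈ dom ∪ W) :
    GreedyState p L F (dom ∪ W) (fun v => if v ∈ W then c else g v) := by
  set g' : V → ℕ := fun v => if v ∈ W then c else g v with hg'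
  have hgW : ∀ v ∈ W, g' v = c := fun v hv => by simp [hg', hv]
  have hnot : ∀ v ∈ dom, v ∉ W := fun v hv hvW => Finset.disjoint_left.1 hdisj hvW hv
  have hgd : ∀ v ∈ dom, g' v = g v := fun v hv => by simp [hg', hnot v hv]
  have hcls : ∀ d, colourClass dom g d ⊆ colourClass (dom ∪ W) g' d := fun d v hv => by
    rw [mem_colourClass] at hv ⊢
    exact ⟨Finset.mem_union_left _ hv.1, by rw [hgd v hv.1]; exact hv.2⟩
  have hclsc : W ∪ colourClass dom g c ⊆ colourClass (dom ∪ W) g' c := by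
    refine Finset.union_subset (fun v hv => ?_) (hcls c)
    exact mem_colourClass.2 ⟨Finset.mem_union_right _ hv, hgW v hv⟩
  have hU : ∀ a' d, ((part p a' \ (dom ∪ W)) ∩ occ L d).card ≤
      ((part p a' \ dom) ∩ occ L d).card := fun a' d =>
    Finset.card_le_card (Finset.inter_subset_inter_right
      (Finset.sdiff_subset_sdiff (Finset.Subset.refl _) Finset.subset_union_left))
  have hfree : ∀ v ∈ dom, p v = a → g v ∉ F := fun v hv hva hvF => by
    obtain ⟨w, hw⟩ := hW
    exact hnot w (h.full v hv hvF w ((hWa w hw).trans hva.symm)) hw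
  constructor
  · intro v hv
    rcases Finset.mem_union.1 hv with hv | hv
    · exact h.big v hv
    · rw [hWa v hv]; exact ha
  · intro v hv
    rcases Finset.mem_union.1 hv with hv | hv
    · rw [hgd v hv]; exact h.mem v hv
    · rw [hgW v hv]; exact hWc v hv
  · intro u hu v hv huv
    rcases Finset.mem_union.1 hu with hu | hu <;> rcases Finset.mem_union.1 hv with hv | hv
    · rw [hgd u hu, hgd v hv] at huv
      exact h.proper u hu v hv huv
    · rw [hgd u hu, hgW v hv] at huv
      rw [hca u hu huv, hWa v hv]
    · rw [hgW u hu, hgd v hv] at huv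
      rw [hca v hv huv.symm, hWa u hu]
    · rw [hWa u hu, hWa v hv]
  · intro v hv hvF a' ha'
    refine (hU a' _).trans ?_
    rcases Finset.mem_union.1 hv with hv | hv
    · rw [hgd v hv] at hvF ⊢
      exact (h.card_le v hv hvF a' ha').trans (Finset.card_le_card (hcls _))
    · rw [hgW v hv] at hvF ⊢
      exact (hQ hvF a' ha').trans (Finset.card_le_card hclsc)
  · intro v hv hvF
    rcases Finset.mem_union.1 hv with hv | hv
    · rw [hgd v hv] at hvF ⊢
      exact (h.two_le v hv hvF).trans (Finset.card_le_card (hcls _))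
    · rw [hgW v hv] at hvF ⊢
      exact (hF hvF).2.1.trans (Finset.card_le_card
        (Finset.subset_union_left.trans hclsc))
  · intro v hv hvF u huv
    rcases Finset.mem_union.1 hv with hv | hv
    · rw [hgd v hv] at hvF
      exact Finset.mem_union_left _ (h.full v hv hvF u huv)
    · rw [hgW v hv] at hvF
      exact (hF hvF).2.2 u (huv.trans (hWa v hv))
  · intro u hu v hv huv huF hvF
    rcases Finset.mem_union.1 hu with hu | hu <;> rcases Finset.mem_union.1 hv with hv | hv
    · rw [hgd u hu] at huF ⊢
      rw [hgd v hv] at hvF ⊢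
      exact h.unique u hu v hv huv huF hvF
    · rw [hgd u hu] at huF
      exact absurd huF (hfree u hu (huv.trans (hWa v hv)))
    · rw [hgd v hv] at hvF
      exact absurd hvF (hfree v hv (huv.symm.trans (hWa u hu)))
    · rw [hgW u hu, hgW v hv]

theorem exists_terminalState (h : GreedyState p L F dom g) :
    ∃ (dom' : Finset V) (g' : V → ℕ), TerminalState p L F dom' g' ∧
      Extends dom' g' dom g := by
  classical
  obtain ⟨D, hD, hmax⟩ := ((Finset.univ : Finset (Finset V)).filter
    (fun D => ∃ g', GreedyState p L F D g' ∧ Extends D g' dom g)).exists_max_image Finset.card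
    ⟨dom, Finset.mem_filter.2 ⟨Finset.mem_univ _, g, h, Finset.Subset.refl _, fun _ _ => rfl⟩⟩
  obtain ⟨g', hg', hext⟩ := (Finset.mem_filter.1 hD).2
  refine ⟨D, g', ⟨hg', fun D'' g'' h'' hext'' => hmax D'' (Finset.mem_filter.2
    ⟨Finset.mem_univ _, g'', h'', hext.1.trans hext''.1, fun v hv => ?_⟩)⟩, hext⟩
  rw [hext''.2 v (hext.1 hv), hext.2 v hv]

end GreedyState

namespace TerminalState
variable {p : V → ℕ} {L : V → Finset ℕ} {F : Finset ℕ} {dom : Finset V} {g : V → ℕ}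

theorem not_extend (ht : TerminalState p L F dom g) {W : Finset V} {c : ℕ}
    (hW : W.Nonempty) (hdisj : Disjoint W dom)
    (h : GreedyState p L F (dom ∪ W) (fun v => if v ∈ W then c else g v)) : False := by
  have h1 := ht.card_le_card _ _ h ⟨Finset.subset_union_left, fun v hv => by
    have : v ∉ W := fun hvW => Finset.disjoint_left.1 hdisj hvW hv
    simp [this]⟩
  rw [Finset.card_union_of_disjoint hdisj.symm] at h1
  have := Finset.card_pos.2 hW
  omega

theorem used_of_common (h : TerminalState p L F dom g) {a c : ℕ} (ha : a ∈ bigLabels p) (hc : c ∈ F)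
    (hU : 2 ≤ (part p a \ dom).card) (hcU : ∀ w ∈ part p a \ dom, c ∈ L w) :
    ∃ u ∈ dom, g u = c := by
  by_contra! hcon
  have hne : (part p a \ dom).Nonempty := Finset.card_pos.1 (by omega)
  have hdisj : Disjoint (part p a \ dom) dom := Finset.sdiff_disjoint
  refine h.not_extend hne hdisj (h.extend hne hdisj (fun w hw => ?_) ha hcU
    (fun u hu hgu => absurd hgu (hcon u hu)) (fun hcF => absurd hc hcF)
    fun _ => ⟨hcon, hU, fun u hu => ?_⟩)
  · exact mem_part.1 (Finset.mem_sdiff.1 hw).1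
  · by_cases hud : u ∈ dom
    · exact Finset.mem_union_left _ hud
    · exact Finset.mem_union_right _ (Finset.mem_sdiff.2 ⟨mem_part.2 hu, hud⟩)

theorem used_of_mem (h : TerminalState p L F dom g) {c : ℕ} {w : V} (hw : p w ∈ bigLabels p) (hwd : w ∉ dom) (hc : c ∉ F)
    (hcw : c ∈ L w) : ∃ u ∈ dom, g u = c := by
  by_contra! hcon
  obtain ⟨a, ha, hbest⟩ := (bigLabels p).exists_max_image
    (fun a => ((part p a \ dom) ∩ occ L c).card) ⟨_, hw⟩
  have hne : ((part p a \ dom) ∩ occ L c).Nonempty := by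
    refine Finset.card_pos.1 (lt_of_lt_of_le (Finset.card_pos.2 ⟨w, ?_⟩) (hbest _ hw))
    simp [hwd, hcw]
  have hdisj : Disjoint ((part p a \ dom) ∩ occ L c) dom :=
    Finset.disjoint_of_subset_left Finset.inter_subset_left Finset.sdiff_disjoint
  refine h.not_extend hne hdisj (h.extend hne hdisj (fun w hw => ?_) ha (fun w hw => ?_)
    (fun u hu hgu => absurd hgu (hcon u hu)) (fun _ a' ha' => ?_) (fun hcF => absurd hcF hc))
  · exact mem_part.1 (Finset.mem_sdiff.1 (Finset.mem_inter.1 hw).1).1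
  · exact mem_occ.1 (Finset.mem_inter.1 hw).2
  · exact (hbest a' ha').trans (Finset.card_le_card Finset.subset_union_left)

theorem notMem_of_used (h : TerminalState p L F dom g) {u w : V} (hu : u ∈ dom) (huF : g u ∉ F) (hw : w ∉ dom)
    (huw : p w = p u) : g u ∉ L w := by
  intro hcon
  have hdisj : Disjoint {w} dom := Finset.disjoint_singleton_left.2 hw
  refine h.not_extend (Finset.singleton_nonempty w) hdisj
    (h.extend (a := p u) (c := g u) (Finset.singleton_nonempty w) hdisj
    (fun x hx => ?_) (h.big u hu) (fun x hx => ?_) (fun x hx hgx => h.proper x hx u hu hgx)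
    (fun _ a' ha' => ?_) (fun hcF => absurd hcF huF))
  · rw [Finset.mem_singleton.1 hx, huw]
  · rwa [Finset.mem_singleton.1 hx]
  · exact (h.card_le u hu huF a' ha').trans (Finset.card_le_card Finset.subset_union_right)

end TerminalState

/-- There is a proper partial colouring from the lists, avoiding the singleton parts, that colours
many vertices using few colours of `F`. -/
def HasEfficientColouring (p : V → ℕ) (k : ℕ) (L : V → Finset ℕ) (F : Finset ℕ) : Prop :=
  ∃ (dom : Finset V) (g : V → ℕ), (∀ v ∈ dom, p v ∈ bigLabels p) ∧ (∀ v ∈ dom, g v ∈ L v) ∧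
    (∀ u ∈ dom, ∀ v ∈ dom, g u = g v → p u = p v) ∧
    Fintype.card V + (F ∩ dom.image g).card ≤ dom.card + k

theorem sum_card_eq_sum_card_inter_occ (L : V → Finset ℕ) (A : Finset V) :
    ∑ v ∈ A, (L v).card = ∑ c ∈ pot L, (A ∩ occ L c).card := by
  rw [← sum_card_inter_eq]
  refine Finset.sum_congr rfl fun v _ => ?_
  rw [Finset.inter_eq_left.2 fun c hc => mem_pot.2 ⟨v, hc⟩]

namespace CriticalList
variable {p : V → ℕ} {k : ℕ} {L : V → Finset ℕ} {F : Finset ℕ} {dom : Finset V} {g : V → ℕ}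

theorem mul_card_le_sum_inter_occ (h : CriticalList p k L) (A : Finset V) :
    A.card * k ≤ ∑ c ∈ pot L, (A ∩ occ L c).card := by
  rw [← sum_card_eq_sum_card_inter_occ, ← smul_eq_mul]
  exact Finset.card_nsmul_le_sum _ _ _ fun v _ => h.le_card v

theorem card_part_inter_occ_lt (h : CriticalList p k L) {a : ℕ} (ha : a ∈ bigLabels p) (c : ℕ) :
    (part p a ∩ occ L c).card < (part p a).card := by
  obtain ⟨v, hv, hcv⟩ := h.exists_notMem ha c
  refine Finset.card_lt_card ⟨Finset.inter_subset_left, fun hsub => hcv ?_⟩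
  exact mem_occ.1 (Finset.mem_inter.1 (hsub (mem_part.2 hv))).2

theorem efficient_of_card_le_one (h : CriticalList p k L) (hg : GreedyState p L F dom g)
    (hU : ∀ a ∈ bigLabels p, (part p a \ dom).card ≤ 1) : HasEfficientColouring p k L F := by
  have := h.nonempty
  refine ⟨dom, g, hg.big, hg.mem, hg.proper, ?_⟩
  have h1 : ∀ c ∈ F ∩ dom.image g, ∃ v ∈ dom, g v = c := fun c hc =>
    Finset.mem_image.1 (Finset.mem_inter.1 hc).2
  choose! r hrd hrg using h1
  have hrF : ∀ c ∈ F ∩ dom.image g, g (r c) ∈ F := fun c hc => by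
    rw [hrg c hc]; exact (Finset.mem_inter.1 hc).1
  have h2 : ((F ∩ dom.image g).image (fun c => p (r c))).card = (F ∩ dom.image g).card := by
    refine Finset.card_image_of_injOn fun c hc d hd hcd => ?_
    have := hg.unique (r c) (hrd c hc) (r d) (hrd d hd) hcd (hrF c hc) (hrF d hd)
    rwa [hrg c hc, hrg d hd] at this
  have h3 : ((Finset.univ \ dom).image p).card = (Finset.univ \ dom).card := by
    refine Finset.card_image_of_injOn fun u hu v hv huv => ?_
    by_cases hvT : v ∈ singles p
    · exact mem_singles.1 hvT u huv
    · have hb := notMem_singles_iff.1 hvT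
      refine Finset.card_le_one.1 (hU _ hb) u ?_ v ?_
      · exact Finset.mem_sdiff.2 ⟨mem_part.2 huv, (Finset.mem_sdiff.1 hu).2⟩
      · exact Finset.mem_sdiff.2 ⟨mem_part.2 rfl, (Finset.mem_sdiff.1 hv).2⟩
  have h4 : Disjoint ((Finset.univ \ dom).image p)
      ((F ∩ dom.image g).image (fun c => p (r c))) := by
    rw [Finset.disjoint_left]
    intro a ha hb
    obtain ⟨u, hu, rfl⟩ := Finset.mem_image.1 ha
    obtain ⟨c, hc, hcu⟩ := Finset.mem_image.1 hb
    exact (Finset.mem_sdiff.1 hu).2 (hg.full _ (hrd c hc) (hrF c hc) u hcu.symm)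
  have h5 := Finset.card_union_of_disjoint h4
  have h6 : (Finset.univ \ dom).image p ∪ (F ∩ dom.image g).image (fun c => p (r c)) ⊆
      Finset.univ.image p := by
    refine Finset.union_subset (Finset.image_subset_image (Finset.subset_univ _)) fun a ha => ?_
    obtain ⟨c, _, rfl⟩ := Finset.mem_image.1 ha
    exact Finset.mem_image_of_mem _ (Finset.mem_univ _)
  have h7 := Finset.card_le_card h6
  rw [h.card_image] at h7
  have h8 := Finset.card_sdiff_add_card_eq_card (Finset.subset_univ dom)
  rw [Finset.card_univ] at h8
  omega

/-- A terminal state yields an efficient colouring, unless it uses no colour of `F` and no colour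
twice. -/
theorem efficient_or_of_terminalState (h : CriticalList p k L) (hF : F ⊆ pot L)
    (hFk : F.card = k) (ht : TerminalState p L F dom g) :
    HasEfficientColouring p k L F ∨ (Fintype.card V = 2 * k + 1 ∧ (∀ v ∈ dom, g v ∉ F) ∧
      ∀ v ∈ dom, (colourClass dom g (g v)).card ≤ 1) := by
  by_cases hU : ∀ a ∈ bigLabels p, (part p a \ dom).card ≤ 1
  · exact Or.inl (h.efficient_of_card_le_one ht.toGreedyState hU)
  push Not at hU
  obtain ⟨a, ha, hu⟩ := hU
  set U := part p a \ dom with hUdef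
  set β : ℕ → ℕ := fun c => if c ∈ F then (U.card - 1) + ((colourClass dom g c).card - 1)
    else (colourClass dom g c).card with hβ
  have hle : ∀ c ∈ pot L, (U ∩ occ L c).card ≤ β c := fun c _ => by
    by_cases hcF : c ∈ F
    · simp only [hβ, hcF, if_true]
      by_cases hcu : ∃ v ∈ dom, g v = c
      · obtain ⟨v, hv, rfl⟩ := hcu
        have := ht.two_le v hv hcF
        have := Finset.card_le_card (Finset.inter_subset_left (s₁ := U) (s₂ := occ L (g v)))
        omega
      · have : (U ∩ occ L c).card < U.card := by
          refine Finset.card_lt_card ⟨Finset.inter_subset_left, fun hsub => hcu ?_⟩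
          exact ht.used_of_common ha hcF hu fun w hw =>
            mem_occ.1 (Finset.mem_inter.1 (hsub hw)).2
        omega
    · simp only [hβ, hcF, if_false]
      rcases Finset.eq_empty_or_nonempty (U ∩ occ L c) with he | ⟨w, hw⟩
      · rw [he]; simp
      · obtain ⟨hwU, hwc⟩ := Finset.mem_inter.1 hw
        obtain ⟨hwa, hwd⟩ := Finset.mem_sdiff.1 hwU
        obtain ⟨v, hv, rfl⟩ := ht.used_of_mem (by rw [mem_part.1 hwa]; exact ha) hwd hcF
          (mem_occ.1 hwc)
        exact ht.card_le v hv hcF a ha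
  have hdomsum : dom.card = ∑ c ∈ pot L, (colourClass dom g c).card :=
    Finset.card_eq_sum_card_fiberwise fun v hv => mem_pot.2 ⟨v, ht.mem v hv⟩
  have hβsum : ∑ c ∈ pot L, β c + (F ∩ dom.image g).card = dom.card + k * (U.card - 1) := by
    have h1 : (F ∩ dom.image g).card = ∑ c ∈ pot L, if c ∈ F ∩ dom.image g then 1 else 0 := by
      rw [← Finset.sum_filter, ← Finset.card_eq_sum_ones, Finset.filter_mem_eq_inter,
        Finset.inter_eq_right.2 (Finset.inter_subset_left.trans hF)]
    have h2 : k * (U.card - 1) = ∑ c ∈ pot L, if c ∈ F then U.card - 1 else 0 := by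
      rw [← Finset.sum_filter, Finset.filter_mem_eq_inter, Finset.inter_eq_right.2 hF,
        Finset.sum_const, smul_eq_mul, hFk]
    rw [h1, h2, hdomsum, ← Finset.sum_add_distrib, ← Finset.sum_add_distrib]
    refine Finset.sum_congr rfl fun c _ => ?_
    by_cases hcF : c ∈ F
    · by_cases hcu : c ∈ dom.image g
      · obtain ⟨v, hv, rfl⟩ := Finset.mem_image.1 hcu
        have := ht.two_le v hv hcF
        simp only [hβ, hcF, hcu, Finset.mem_inter, and_self, if_true]
        omega
      · have : colourClass dom g c = ∅ := by
          ext v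
          simp only [mem_colourClass, Finset.notMem_empty, iff_false]
          rintro ⟨hv, rfl⟩
          exact hcu (Finset.mem_image_of_mem _ hv)
        simp [hβ, hcF, hcu, this]
    · simp [hβ, hcF]
  have hcount := h.mul_card_le_sum_inter_occ U
  have hsumle := Finset.sum_le_sum hle
  have hmul : U.card * k = k * (U.card - 1) + k := by
    obtain ⟨m, hm⟩ := Nat.exists_eq_add_of_lt hu
    rw [hm]
    simp only [Nat.add_sub_cancel]
    ring
  have hnk := h.card_le
  by_cases hsucc : Fintype.card V + (F ∩ dom.image g).card ≤ dom.card + k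
  · exact Or.inl ⟨dom, g, ht.big, ht.mem, ht.proper, hsucc⟩
  have htight : ∀ c ∈ pot L, (U ∩ occ L c).card = β c :=
    (Finset.sum_eq_sum_iff_of_le hle).1 (by omega)
  have hQused : ∀ v ∈ dom, g v ∉ F → (U ∩ occ L (g v)).card = (colourClass dom g (g v)).card :=
    fun v hv hvF => by
      have := htight _ (mem_pot.2 ⟨v, ht.mem v hv⟩)
      simpa only [hβ, hvF, if_false] using this
  have hUP : U = part p a := by
    rw [hUdef, Finset.sdiff_eq_self_iff_disjoint, Finset.disjoint_right]
    intro v hv hva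
    rw [mem_part] at hva
    by_cases hvF : g v ∈ F
    · obtain ⟨w, hw⟩ := Finset.card_pos.1 (lt_trans Nat.zero_lt_one hu)
      obtain ⟨hwa, hwd⟩ := Finset.mem_sdiff.1 hw
      exact hwd (ht.full v hv hvF w (by rw [mem_part.1 hwa, hva]))
    · have h1 := hQused v hv hvF
      have h2 : 0 < (colourClass dom g (g v)).card :=
        Finset.card_pos.2 ⟨v, mem_colourClass.2 ⟨hv, rfl⟩⟩
      rw [← h1] at h2
      obtain ⟨w, hw⟩ := Finset.card_pos.1 h2
      obtain ⟨hwU, hwc⟩ := Finset.mem_inter.1 hw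
      obtain ⟨hwa, hwd⟩ := Finset.mem_sdiff.1 hwU
      exact ht.notMem_of_used hv hvF hwd (by rw [mem_part.1 hwa, hva]) (mem_occ.1 hwc)
  have hnoF : ∀ v ∈ dom, g v ∉ F := fun v hv hvF => by
    have h1 := htight _ (hF hvF)
    simp only [hβ, hvF, if_true] at h1
    have h2 := ht.two_le v hv hvF
    have h3 := h.card_part_inter_occ_lt ha (g v)
    rw [← hUP] at h3
    omega
  have hi : F ∩ dom.image g = ∅ := by
    ext c
    simp only [Finset.mem_inter, Finset.mem_image, Finset.notMem_empty, iff_false, not_and]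
    rintro hc ⟨v, hv, rfl⟩
    exact hnoF v hv hc
  rw [hi, Finset.card_empty] at hβsum hsucc
  have hFocc : ∀ c ∈ F, (U ∩ occ L c).card = U.card - 1 := fun c hc => by
    have h1 := htight c (hF hc)
    have h2 : colourClass dom g c = ∅ := by
      ext v
      simp only [mem_colourClass, Finset.notMem_empty, iff_false]
      rintro ⟨hv, rfl⟩
      exact hnoF v hv hc
    simpa [hβ, hc, h2] using h1
  by_cases hu3 : 3 ≤ U.card
  · left
    obtain ⟨c, hc⟩ := Finset.card_pos.1 (hFk.symm ▸ h.k_pos : 0 < F.card)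
    set W := U ∩ occ L c with hW
    have hdisj : Disjoint dom W := Finset.disjoint_of_subset_right Finset.inter_subset_left
      Finset.disjoint_sdiff
    have hWd : ∀ v ∈ dom, v ∉ W := fun v hv hvW => Finset.disjoint_left.1 hdisj hv hvW
    have hWa : ∀ v ∈ W, p v = a := fun v hv => by
      have := (Finset.mem_inter.1 hv).1
      rw [hUP] at this
      exact mem_part.1 this
    refine ⟨dom ∪ W, fun v => if v ∈ W then c else g v, ?_, ?_, ?_, ?_⟩
    · intro v hv
      rcases Finset.mem_union.1 hv with hv | hv
      · exact ht.big v hv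
      · rw [hWa v hv]; exact ha
    · intro v hv
      rcases Finset.mem_union.1 hv with hv | hv
      · simp only [hWd v hv, if_false]; exact ht.mem v hv
      · simp only [hv, if_true]; exact mem_occ.1 (Finset.mem_inter.1 hv).2
    · intro u hu v hv huv
      rcases Finset.mem_union.1 hu with hu | hu <;> rcases Finset.mem_union.1 hv with hv | hv
      · simp only [hWd v hv, hWd u hu, if_false] at huv
        exact ht.proper u hu v hv huv
      · simp only [hv, hWd u hu, if_false, if_true] at huv
        exact absurd (huv ▸ hc) (hnoF u hu)
      · simp only [hu, hWd v hv, if_false, if_true] at huv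
        exact absurd (huv ▸ hc) (hnoF v hv)
      · rw [hWa u hu, hWa v hv]
    · have h1 : F ∩ (dom ∪ W).image (fun v => if v ∈ W then c else g v) ⊆ {c} := by
        intro d hd
        obtain ⟨hdF, hd⟩ := Finset.mem_inter.1 hd
        obtain ⟨v, hv, rfl⟩ := Finset.mem_image.1 hd
        rcases Finset.mem_union.1 hv with hv | hv
        · simp only [hWd v hv, if_false] at hdF
          exact absurd hdF (hnoF v hv)
        · simp [hv]
      have h2 := Finset.card_le_card h1
      rw [Finset.card_singleton] at h2
      rw [Finset.card_union_of_disjoint hdisj]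
      have h3 := hFocc c hc
      rw [← hW] at h3
      omega
  · right
    refine ⟨by omega, hnoF, fun v hv => ?_⟩
    rw [← hQused v hv (hnoF v hv)]
    have h3 := h.card_part_inter_occ_lt ha (g v)
    rw [← hUP] at h3
    omega

theorem hasEfficientColouring (h : CriticalList p k L) (hF : F ⊆ pot L) (hFk : F.card = k) :
    HasEfficientColouring p k L F := by
  have hk := h.k_pos
  have hkt := h.card_eq
  have hempty := greedyState_empty p L F (fun _ => 0)
  by_cases hn : Fintype.card V = 2 * k + 1
  swap
  · obtain ⟨dom, g, ht, -⟩ := hempty.exists_terminalState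
    exact (h.efficient_or_of_terminalState hF hFk ht).resolve_right fun hcon => hn hcon.1
  by_cases hQ : ∃ c, c ∉ F ∧ ∃ a ∈ bigLabels p, 2 ≤ (part p a ∩ occ L c).card
  · obtain ⟨c, hcF, a₀, ha₀, hca₀⟩ := hQ
    obtain ⟨a, ha, hbest⟩ := (bigLabels p).exists_max_image
      (fun a => (part p a ∩ occ L c).card) ⟨_, ha₀⟩
    have h2 : 2 ≤ (part p a ∩ occ L c).card := hca₀.trans (hbest _ ha₀)
    have hne : (part p a ∩ occ L c).Nonempty := Finset.card_pos.1 (by omega)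
    have hstart := hempty.extend hne (Finset.disjoint_empty_right _)
      (fun w hw => mem_part.1 (Finset.mem_inter.1 hw).1) ha
      (fun w hw => mem_occ.1 (Finset.mem_inter.1 hw).2) (c := c) (by simp)
      (fun _ a' ha' => by
        rw [Finset.sdiff_empty]
        exact (hbest a' ha').trans (Finset.card_le_card Finset.subset_union_left))
      (fun hcon => absurd hcon hcF)
    obtain ⟨dom, g, ht, hsub, hext⟩ := hstart.exists_terminalState
    refine (h.efficient_or_of_terminalState hF hFk ht).resolve_right fun ⟨_, _, hcon⟩ => ?_
    have hcol : ∀ v ∈ part p a ∩ occ L c, v ∈ dom ∧ g v = c := fun v hv => by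
      refine ⟨hsub (Finset.mem_union_right _ hv), ?_⟩
      rw [hext v (Finset.mem_union_right _ hv)]
      simp only [hv, if_true]
    obtain ⟨v, hv⟩ := hne
    have h3 := hcon v (hcol v hv).1
    rw [(hcol v hv).2] at h3
    have h4 : part p a ∩ occ L c ⊆ colourClass dom g c := fun u hu =>
      mem_colourClass.2 (hcol u hu)
    have := Finset.card_le_card h4
    omega
  push Not at hQ
  obtain ⟨a, ha, ha3⟩ : ∃ a ∈ bigLabels p, 3 ≤ (part p a).card := by
    by_contra! hcon
    have h1 := card_eq_sum_parts p
    have h2 := Finset.sum_le_card_nsmul (bigLabels p) (fun a => (part p a).card) 2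
      fun a ha => Nat.le_of_lt_succ (hcon a ha)
    rw [smul_eq_mul] at h2
    omega
  set P := part p a with hP
  set β : ℕ → ℕ := fun c => if c ∈ F then P.card - 1 else 1 with hβ
  have hle : ∀ c ∈ pot L, (P ∩ occ L c).card ≤ β c := fun c _ => by
    by_cases hcF : c ∈ F
    · simp only [hβ, hcF, if_true]
      have := h.card_part_inter_occ_lt ha c
      rw [← hP] at this
      omega
    · simp only [hβ, hcF, if_false]
      have := hQ c hcF a ha
      rw [← hP] at this
      omega
  have hFc := Finset.card_sdiff_add_card_eq_card hF
  have hβsum : ∑ c ∈ pot L, β c = k * (P.card - 1) + (pot L \ F).card := by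
    rw [← Finset.sum_sdiff hF, add_comm]
    congr 1
    · rw [Finset.sum_congr rfl (g := fun _ => P.card - 1) (fun c hc => by simp [hβ, hc]),
        Finset.sum_const, smul_eq_mul, hFk]
    · rw [Finset.sum_congr rfl (g := fun _ => 1)
        (fun c hc => by simp [hβ, (Finset.mem_sdiff.1 hc).2]), ← Finset.card_eq_sum_ones]
  have hmul : P.card * k = k * (P.card - 1) + k := by
    obtain ⟨m, hm⟩ := Nat.exists_eq_add_of_le ha3
    rw [hm, show 3 + m - 1 = m + 2 by omega]
    ring
  have hpot := h.card_pot_lt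
  have hcount := h.mul_card_le_sum_inter_occ P
  have hsumle := Finset.sum_le_sum hle
  have htight : ∀ c ∈ pot L, (P ∩ occ L c).card = β c :=
    (Finset.sum_eq_sum_iff_of_le hle).1 (by omega)
  obtain ⟨c, hc⟩ := Finset.card_pos.1 (show 0 < (pot L \ F).card by omega)
  obtain ⟨hcp, hcF⟩ := Finset.mem_sdiff.1 hc
  have hc1 := htight c hcp
  simp only [hβ, hcF, if_false] at hc1
  obtain ⟨v, hv⟩ := Finset.card_pos.1 (show 0 < (P ∩ occ L c).card by omega)
  obtain ⟨hvP, hcv⟩ := Finset.mem_inter.1 hv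
  rw [mem_occ] at hcv
  have hva := mem_part.1 hvP
  have hLv : (L v).card ≤ k := by
    have h1 := sum_card_eq_sum_card_inter_occ L P
    have h2 : (P.erase v).card * k ≤ ∑ w ∈ P.erase v, (L w).card := by
      rw [← smul_eq_mul]
      exact Finset.card_nsmul_le_sum _ _ _ fun w _ => h.le_card w
    rw [← Finset.add_sum_erase _ _ hvP] at h1
    rw [Finset.card_erase_of_mem hvP, mul_comm] at h2
    omega
  obtain ⟨d, hdF, hdv⟩ : ∃ d ∈ F, d ∉ L v := by
    by_contra! hcon
    have h1 : insert c F ⊆ L v := Finset.insert_subset hcv hcon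
    have h2 := Finset.card_le_card h1
    rw [Finset.card_insert_of_notMem hcF] at h2
    omega
  have hd1 := htight d (hF hdF)
  simp only [hβ, hdF, if_true] at hd1
  have hdP : P ∩ occ L d = P.erase v := by
    apply Finset.eq_of_subset_of_card_le
    · intro w hw
      obtain ⟨hwP, hwd⟩ := Finset.mem_inter.1 hw
      refine Finset.mem_erase.2 ⟨fun hwv => hdv ?_, hwP⟩
      rw [← hwv]
      exact mem_occ.1 hwd
    · rw [Finset.card_erase_of_mem hvP, hd1]
  have hs1 := hempty.extend (W := {v}) (a := a) (c := c) (Finset.singleton_nonempty v)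
    (Finset.disjoint_empty_right _) (fun w hw => by rw [Finset.mem_singleton.1 hw, hva]) ha
    (fun w hw => by rwa [Finset.mem_singleton.1 hw]) (by simp)
    (fun _ a' ha' => by
      rw [Finset.sdiff_empty]
      have h1 := hQ c hcF a' ha'
      have h2 := Finset.card_le_card
        (Finset.subset_union_left (s₁ := {v}) (s₂ := colourClass ∅ (fun _ => 0) c))
      rw [Finset.card_singleton] at h2
      omega)
    (fun hcon => absurd hcon hcF)
  have hdc : d ≠ c := fun hdc => hcF (hdc ▸ hdF)
  have hPe : (P.erase v).card = P.card - 1 := Finset.card_erase_of_mem hvP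
  have hs2 := hs1.extend (W := P.erase v) (a := a) (c := d) (Finset.card_pos.1 (by omega))
    (by simp) (fun w hw => mem_part.1 (Finset.mem_of_mem_erase hw)) ha
    (fun w hw => by
      rw [← hdP] at hw
      exact mem_occ.1 (Finset.mem_inter.1 hw).2)
    (fun u hu _ => by
      have : u = v := by simpa using hu
      rw [this, hva])
    (fun hcon => absurd hdF hcon)
    (fun _ => ⟨fun u hu => by
      have : u = v := by simpa using hu
      simpa [this] using hdc.symm, by omega, fun u hu => by
      by_cases huv : u = v
      · simp [huv]
      · exact Finset.mem_union_right _ (Finset.mem_erase.2 ⟨huv, mem_part.2 hu⟩)⟩)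
  obtain ⟨dom, g, ht, hsub, hext⟩ := hs2.exists_terminalState
  refine (h.efficient_or_of_terminalState hF hFk ht).resolve_right fun ⟨_, hcon, _⟩ => ?_
  obtain ⟨w, hw⟩ := Finset.card_pos.1 (show 0 < (P.erase v).card by omega)
  have hgw := hext w (Finset.mem_union_right _ hw)
  simp only [hw, if_true] at hgw
  refine hcon w (hsub (Finset.mem_union_right _ hw)) ?_
  rw [hgw]
  exact hdF

/-- An efficient colouring can be completed to a colouring that is acceptable up to frequent
colours on single vertices. -/
theorem not_hasEfficientColouring (h : CriticalList p k L) {F₀ : Finset ℕ} {T₁ : Finset V}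
    {ζ : V → ℕ} (hF₀ : F₀ ⊆ frequent p k L) (hT₁ : T₁ ⊆ singles p)
    (hcard : F₀.card + T₁.card = k) (hζ : ∀ v ∈ T₁, ζ v ∈ L v ∧ ζ v ∉ F₀)
    (hinj : ∀ u ∈ T₁, ∀ v ∈ T₁, ζ u = ζ v → u = v) :
    ¬ HasEfficientColouring p k L (F₀ ∪ T₁.image ζ) := by
  rintro ⟨dom, g, hbig, hmem, hproper, hsucc⟩
  set A := T₁.filter (fun v => ζ v ∉ dom.image g) with hA
  set R := (Finset.univ \ dom) \ A with hR
  have hAdom : ∀ v ∈ A, v ∉ dom := fun v hv hvd =>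
    notMem_singles_iff.2 (hbig v hvd) (hT₁ (Finset.mem_filter.1 hv).1)
  have hRcard : R.card + A.card + dom.card = Fintype.card V := by
    have h1 : A ⊆ Finset.univ \ dom := fun v hv =>
      Finset.mem_sdiff.2 ⟨Finset.mem_univ _, hAdom v hv⟩
    have h2 : R.card + A.card = _ := Finset.card_sdiff_add_card_eq_card h1
    have h3 := Finset.card_sdiff_add_card_eq_card (Finset.subset_univ dom)
    rw [Finset.card_univ] at h3
    omega
  have hFsum : (F₀ ∩ dom.image g).card + (F₀ \ dom.image g).card = F₀.card := by
    have := Finset.card_sdiff_add_card_inter F₀ (dom.image g)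
    omega
  have hAsum : (T₁.image ζ ∩ dom.image g).card + A.card = T₁.card := by
    have h1 := Finset.card_filter_add_card_filter_not (s := T₁) (fun v => ζ v ∈ dom.image g)
    have h2 : (T₁.image ζ ∩ dom.image g) = (T₁.filter (fun v => ζ v ∈ dom.image g)).image ζ := by
      ext c
      simp only [Finset.mem_inter, Finset.mem_image, Finset.mem_filter]
      constructor
      · rintro ⟨⟨v, hv, rfl⟩, hc⟩
        exact ⟨v, ⟨hv, hc⟩, rfl⟩
      · rintro ⟨v, ⟨hv, hc⟩, rfl⟩
        exact ⟨⟨v, hv, rfl⟩, hc⟩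
    rw [h2, Finset.card_image_of_injOn fun u hu v hv huv =>
      hinj u (Finset.mem_filter.1 hu).1 v (Finset.mem_filter.1 hv).1 huv]
    exact h1
  have hinter : ((F₀ ∪ T₁.image ζ) ∩ dom.image g).card =
      (F₀ ∩ dom.image g).card + (T₁.image ζ ∩ dom.image g).card := by
    rw [Finset.union_inter_distrib_right, Finset.card_union_of_disjoint]
    rw [Finset.disjoint_left]
    intro c hc hc'
    obtain ⟨v, hv, rfl⟩ := Finset.mem_image.1 (Finset.mem_inter.1 hc').1
    exact (hζ v hv).2 (Finset.mem_inter.1 hc).1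
  obtain ⟨e, he, heinj⟩ := exists_injOn_of_hall R (fun _ => F₀ \ dom.image g) (fun D hD => by
    rcases D.eq_empty_or_nonempty with rfl | ⟨w, hw⟩
    · simp
    · have h1 : F₀ \ dom.image g ⊆ D.biUnion fun _ => F₀ \ dom.image g :=
        Finset.subset_biUnion_of_mem (fun _ => F₀ \ dom.image g) hw
      have h2 := Finset.card_le_card h1
      have h3 := Finset.card_le_card hD
      omega)
  set f : V → ℕ := fun v => if v ∈ dom then g v else if v ∈ A then ζ v else e v with hf
  have hfd : ∀ v ∈ dom, f v = g v := fun v hv => by simp [hf, hv]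
  have hfA : ∀ v ∈ A, f v = ζ v := fun v hv => by simp [hf, hv, hAdom v hv]
  have hfR : ∀ v, v ∉ dom → v ∉ A → f v = e v ∧ v ∈ R := fun v hvd hvA =>
    ⟨by simp [hf, hvd, hvA], by simp [hR, hvd, hvA]⟩
  have hfAd : ∀ v ∈ A, f v ∉ dom.image g ∧ f v ∉ F₀ := fun v hv => by
    rw [hfA v hv]
    exact ⟨(Finset.mem_filter.1 hv).2, (hζ v (Finset.mem_filter.1 hv).1).2⟩
  have hfRd : ∀ v, v ∉ dom → v ∉ A → f v ∉ dom.image g ∧ f v ∈ F₀ := fun v hvd hvA => by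
    obtain ⟨h1, h2⟩ := hfR v hvd hvA
    have := Finset.mem_sdiff.1 (he v h2)
    rw [h1]
    exact ⟨this.2, this.1⟩
  have huniq : ∀ u, u ∉ dom → ∀ w, f w = f u → w = u := fun u hu w hwu => by
    have hw : w ∉ dom := fun hw => by
      have h1 : f u ∈ dom.image g := by
        rw [← hwu, hfd w hw]
        exact Finset.mem_image_of_mem _ hw
      by_cases huA : u ∈ A
      · exact (hfAd u huA).1 h1
      · exact (hfRd u hu huA).1 h1
    by_cases huA : u ∈ A <;> by_cases hwA : w ∈ A
    · rw [hfA u huA, hfA w hwA] at hwu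
      exact hinj w (Finset.mem_filter.1 hwA).1 u (Finset.mem_filter.1 huA).1 hwu
    · exact absurd (hwu ▸ (hfRd w hw hwA).2) (hfAd u huA).2
    · exact absurd (hwu.symm ▸ (hfRd u hu huA).2) (hfAd w hwA).2
    · rw [(hfR u hu huA).1, (hfR w hw hwA).1] at hwu
      exact heinj w (hfR w hw hwA).2 u (hfR u hu huA).2 hwu
  refine h.not_nearAcceptable f (fun u v huv => ?_) fun u => ?_
  · by_cases hu : u ∈ dom <;> by_cases hv : v ∈ dom
    · rw [hfd u hu, hfd v hv] at huv
      exact hproper u hu v hv huv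
    · rw [huniq v hv u huv]
    · rw [huniq u hu v huv.symm]
    · rw [huniq v hv u huv]
  · by_cases hu : u ∈ dom
    · rw [hfd u hu]; exact Or.inl (hmem u hu)
    · by_cases huA : u ∈ A
      · rw [hfA u huA]; exact Or.inl (hζ u (Finset.mem_filter.1 huA).1).1
      · exact Or.inr ⟨hF₀ (hfRd u hu huA).2, huniq u hu⟩

theorem false (h : CriticalList p k L) : False := by
  have hkt := h.card_eq
  have hb := h.card_bigLabels_le_frequent
  rcases le_or_gt k (frequent p k L).card with hk | hk
  · obtain ⟨F₀, hF₀, hc⟩ := Finset.exists_subset_card_eq hk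
    refine h.not_hasEfficientColouring (F₀ := F₀) (T₁ := ∅) (ζ := fun _ => 0) hF₀
      (Finset.empty_subset _) (by simpa using hc) (by simp) (by simp) ?_
    exact h.hasEfficientColouring (by simpa using hF₀.trans frequent_subset) (by simpa using hc)
  · obtain ⟨T₁, hT₁, hc⟩ := Finset.exists_subset_card_eq
      (show k - (frequent p k L).card ≤ (singles p).card by omega)
    obtain ⟨ζ, hζ, hinj⟩ := exists_injOn_of_hall T₁ (fun v => L v \ frequent p k L)
      (fun D hD => by
        rcases D.eq_empty_or_nonempty with rfl | ⟨w, hw⟩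
        · simp
        · have h1 : L w \ frequent p k L ⊆ D.biUnion fun v => L v \ frequent p k L :=
            Finset.subset_biUnion_of_mem (fun v => L v \ frequent p k L) hw
          have h2 := Finset.card_le_card h1
          have h3 := Finset.card_le_card hD
          have h4 := Finset.le_card_sdiff (frequent p k L) (L w)
          have := h.le_card w
          omega)
    refine h.not_hasEfficientColouring (F₀ := frequent p k L) (T₁ := T₁) (ζ := ζ)
      (Finset.Subset.refl _) hT₁ (by omega) (fun v hv => Finset.mem_sdiff.1 (hζ v hv)) hinj ?_
    refine h.hasEfficientColouring (Finset.union_subset frequent_subset fun c hc => ?_) ?_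
    · obtain ⟨v, hv, rfl⟩ := Finset.mem_image.1 hc
      exact mem_pot.2 ⟨v, (Finset.mem_sdiff.1 (hζ v hv)).1⟩
    · rw [Finset.card_union_of_disjoint, Finset.card_image_of_injOn fun u hu v hv huv =>
        hinj u hu v hv huv]
      · omega
      · rw [Finset.disjoint_left]
        intro c hc hc'
        obtain ⟨v, hv, rfl⟩ := Finset.mem_image.1 hc'
        exact (Finset.mem_sdiff.1 (hζ v hv)).2 hc

end CriticalList
end Ohba

theorem exists_criticalList {V : Type*} [Fintype V] [DecidableEq V] [Nonempty V] {p : V → ℕ}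
    {k : ℕ} {L : V → Finset ℕ} (hp : (Finset.univ.image p).card = k)
    (hn : Fintype.card V ≤ 2 * k + 1) (hL : ∀ v, k ≤ (L v).card)
    (hbad : ¬ PartColourable p Finset.univ L)
    (ih : ∀ (X : Finset V) (k' : ℕ) (L' : V → Finset ℕ), X.card < Fintype.card V →
      (X.image p).card ≤ k' → X.card ≤ 2 * k' + 1 → (∀ v ∈ X, k' ≤ (L' v).card) →
      PartColourable p X L') : ∃ L' : V → Finset ℕ, CriticalList p k L' := by
  classical
  have hex : ∃ m, ∃ L : V → Finset ℕ, ((∀ v, k ≤ (L v).card) ∧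
      ¬ PartColourable p Finset.univ L) ∧ (pot L).card = m := ⟨_, L, ⟨hL, hbad⟩, rfl⟩
  obtain ⟨L₁, hL₁, hm⟩ := Nat.find_spec hex
  have hmin : ∀ L' : V → Finset ℕ, (∀ v, k ≤ (L' v).card) → ¬ PartColourable p Finset.univ L' →
      Nat.find hex ≤ (pot L').card := fun L' h1 h2 => Nat.find_min' hex ⟨L', ⟨h1, h2⟩, rfl⟩
  set m := Nat.find hex with hmdef
  have hex₂ : ∃ r, ∃ L : V → Finset ℕ, ((∀ v, k ≤ (L v).card) ∧
      ¬ PartColourable p Finset.univ L) ∧ (pot L).card = m ∧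
      Fintype.card V * m - ∑ v, (L v).card = r := ⟨_, L₁, hL₁, hm, rfl⟩
  obtain ⟨L₂, ⟨hle, hnot⟩, hm₂, hr⟩ := Nat.find_spec hex₂
  refine ⟨L₂, ‹_›, hp, hn, hle, hnot, ih, fun L' h1 h2 => hm₂ ▸ hmin L' h1 h2, ?_⟩
  intro v c hc hcv
  by_contra hcon
  set L' := Function.update L₂ v (insert c (L₂ v)) with hL'
  have hv : L' v = insert c (L₂ v) := by simp [hL']
  have hu : ∀ u, u ≠ v → L' u = L₂ u := fun u hu => by simp [hL', hu]
  have hsub : pot L' ⊆ pot L₂ := by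
    intro d hd
    obtain ⟨u, hd⟩ := mem_pot.1 hd
    by_cases huv : u = v
    · rw [huv, hv] at hd
      rcases Finset.mem_insert.1 hd with rfl | hd
      · exact hc
      · exact mem_pot.2 ⟨v, hd⟩
    · rw [hu u huv] at hd
      exact mem_pot.2 ⟨u, hd⟩
  have hle' : ∀ u, k ≤ (L' u).card := fun u => by
    by_cases huv : u = v
    · rw [huv, hv]
      exact (hle v).trans (Finset.card_le_card (Finset.subset_insert _ _))
    · rw [hu u huv]; exact hle u
  have hm' : (pot L').card = m :=
    le_antisymm (hm₂ ▸ Finset.card_le_card hsub) (hmin L' hle' hcon)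
  have h1 := Nat.find_min' hex₂ ⟨L', ⟨hle', hcon⟩, hm', rfl⟩
  have h2 : ∑ v, (L' v).card = ∑ v, (L₂ v).card + 1 := by
    rw [← Finset.add_sum_erase _ _ (Finset.mem_univ v),
      ← Finset.add_sum_erase _ (fun v => (L₂ v).card) (Finset.mem_univ v), hv,
      Finset.card_insert_of_notMem hcv,
      Finset.sum_congr rfl fun u hu' => by rw [hu u (Finset.ne_of_mem_erase hu')]]
    omega
  have h3 : ∑ v, (L' v).card ≤ Fintype.card V * m := by
    rw [← Finset.card_univ, ← smul_eq_mul, ← hm']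
    exact Finset.sum_le_card_nsmul _ _ _ fun u _ =>
      Finset.card_le_card fun d hd => mem_pot.2 ⟨u, hd⟩
  rw [← hr] at h1
  omega

theorem partColourable_univ_of_ih {V : Type*} [Fintype V] [DecidableEq V]
    (ih : ∀ (p : V → ℕ) (X : Finset V) (k' : ℕ) (L' : V → Finset ℕ), X.card < Fintype.card V →
      (X.image p).card ≤ k' → X.card ≤ 2 * k' + 1 → (∀ v ∈ X, k' ≤ (L' v).card) →
      PartColourable p X L') (k : ℕ) (hn : Fintype.card V ≤ 2 * k + 1) (L : V → Finset ℕ)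
    (hL : ∀ v, k ≤ (L v).card) (j : ℕ) :
    ∀ p : V → ℕ, (Finset.univ.image p).card + j = k → PartColourable p Finset.univ L := by
  rcases isEmpty_or_nonempty V with hV | hV
  · exact fun p _ => ⟨fun _ => 0, fun v => hV.elim v, fun v => hV.elim v⟩
  induction j with
  | zero =>
    intro p hp
    by_contra hbad
    obtain ⟨L', h⟩ := exists_criticalList hp hn hL hbad (ih p)
    exact h.false
  | succ j hj =>
    intro p hp
    by_cases hinj : Function.Injective p
    · rw [Finset.card_image_of_injective _ hinj, Finset.card_univ] at hp
      obtain ⟨f, hf, hfinj⟩ := exists_injOn_of_hall Finset.univ L (fun D _ => by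
        rcases D.eq_empty_or_nonempty with rfl | ⟨w, hw⟩
        · simp
        · have h1 := Finset.card_le_card (Finset.subset_biUnion_of_mem L hw)
          have h2 := Finset.card_le_univ D
          have h3 := hL w
          omega)
      exact ⟨f, hf, fun u hu v hv huv => by rw [hfinj u hu v hv huv]⟩
    · simp only [Function.Injective, not_forall] at hinj
      obtain ⟨u, v, hpuv, huv⟩ := hinj
      obtain ⟨a, ha⟩ := Infinite.exists_notMem_finset (Finset.univ.image p)
      have ha' : ∀ w, p w ≠ a := fun w hw =>
        ha (Finset.mem_image.2 ⟨w, Finset.mem_univ _, hw⟩)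
      have himg : Finset.univ.image (Function.update p u a) = insert a (Finset.univ.image p) := by
        ext x
        simp only [Finset.mem_image, Finset.mem_univ, true_and, Finset.mem_insert]
        constructor
        · rintro ⟨w, rfl⟩
          by_cases hw : w = u
          · left; simp [hw]
          · right; exact ⟨w, by simp [hw]⟩
        · rintro (rfl | ⟨w, rfl⟩)
          · exact ⟨u, by simp⟩
          · by_cases hw : w = u
            · exact ⟨v, by rw [Function.update_of_ne (Ne.symm huv), hw, hpuv]⟩
            · exact ⟨w, by simp [hw]⟩
      obtain ⟨f, hf, hfp⟩ := hj (Function.update p u a) (by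
        rw [himg, Finset.card_insert_of_notMem ha]
        omega)
      refine ⟨f, hf, fun x hx y hy hxy => ?_⟩
      have h1 := hfp x hx y hy hxy
      by_cases hxu : x = u <;> by_cases hyu : y = u
      · rw [hxu, hyu]
      · rw [hxu, Function.update_self, Function.update_of_ne hyu] at h1
        exact absurd h1.symm (ha' y)
      · rw [hyu, Function.update_self, Function.update_of_ne hxu] at h1
        exact absurd h1 (ha' x)
      · rwa [Function.update_of_ne hxu, Function.update_of_ne hyu] at h1

/-- **Ohba's conjecture** (the Noel–Reed–Wu theorem) for complete multipartite graphs: if the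
fibres of `p` partition `X` into at most `k` parts and `X` has at most `2 * k + 1` vertices, then
the complete multipartite graph on `X` is `k`-choosable. -/
theorem partColourable_of_card_le (m : ℕ) : ∀ {V : Type*} (p : V → ℕ) (X : Finset V) (k : ℕ)
    (L : V → Finset ℕ), X.card = m → (X.image p).card ≤ k → X.card ≤ 2 * k + 1 →
    (∀ v ∈ X, k ≤ (L v).card) → PartColourable p X L := by
  classical
  induction m using Nat.strong_induction_on with
  | _ m ih =>
    intro V p X k L hm hp hX hL
    have key : PartColourable (fun v : {v // v ∈ X} => p v.1) Finset.univ (fun v => L v.1) := by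
      have hcard : Fintype.card {v // v ∈ X} = X.card := Fintype.card_coe X
      have himg : (Finset.univ.image (fun v : {v // v ∈ X} => p v.1)).card = (X.image p).card := by
        congr 1
        ext a
        simp
      refine partColourable_univ_of_ih (V := {v // v ∈ X}) (fun q Y k' L' hY h1 h2 h3 => ?_) k (by omega) _
        (fun v => hL v.1 v.2) (k - (X.image p).card) _ (by omega)
      exact ih Y.card (by omega) q Y k' L' rfl h1 h2 h3
    obtain ⟨f, hf, hfp⟩ := key
    refine ⟨fun v => if hv : v ∈ X then f ⟨v, hv⟩ else 0, fun v hv => ?_, fun u hu v hv huv => ?_⟩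
    · simp only [hv, dif_pos]
      exact hf ⟨v, hv⟩ (Finset.mem_univ _)
    · simp only [hu, hv, dif_pos] at huv
      exact hfp ⟨u, hu⟩ (Finset.mem_univ _) ⟨v, hv⟩ (Finset.mem_univ _) huv

theorem partColourable_of_isLamAssignment {V ι : Type*} [DecidableEq ι] (p : V → ℕ) (w : ι → ℕ)
    (C : ι → Finset ℕ) (hC : ∀ i j, i ≠ j → Disjoint (C i) (C j)) (L : V → Finset ℕ)
    (hL : ∀ v i, w i ≤ (L v ∩ C i).card) (J : Finset ι) :
    ∀ X : Finset V, (X.image p).card ≤ ∑ i ∈ J, w i →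
      X.card ≤ 2 * ∑ i ∈ J, w i + (J.filter (fun i => w i = 1)).card + 1 →
      PartColourable p X (fun v => L v ∩ J.biUnion C) := by
  classical
  induction J using Finset.strongInduction with
  | _ J ih =>
    intro X hp hX
    by_cases hcase : (∃ i ∈ J, w i = 1) ∧ ∃ a, 3 ≤ (X.filter (fun v => p v = a)).card
    · obtain ⟨⟨i, hi, hwi⟩, a, ha⟩ := hcase
      have hsum : ∑ j ∈ J, w j = 1 + ∑ j ∈ J.erase i, w j := by
        rw [← Finset.add_sum_erase _ _ hi, hwi]
      have hcount : (J.filter (fun i => w i = 1)).card =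
          ((J.erase i).filter (fun i => w i = 1)).card + 1 := by
        rw [Finset.filter_erase, Finset.card_erase_add_one]
        exact Finset.mem_filter.2 ⟨hi, hwi⟩
      have hsplit := Finset.card_filter_add_card_filter_not (s := X) (fun v => p v = a)
      obtain ⟨f, hf, hfp⟩ := ih (J.erase i) (Finset.erase_ssubset hi)
        (X.filter (fun v => ¬ p v = a)) (by
          have h1 : (X.filter (fun v => ¬ p v = a)).image p ⊆ (X.image p).erase a := by
            intro b hb
            obtain ⟨v, hv, rfl⟩ := Finset.mem_image.1 hb
            obtain ⟨hvX, hva⟩ := Finset.mem_filter.1 hv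
            exact Finset.mem_erase.2 ⟨hva, Finset.mem_image_of_mem _ hvX⟩
          have h2 := Finset.card_le_card h1
          obtain ⟨v, hv⟩ := Finset.card_pos.1 (show 0 < (X.filter (fun v => p v = a)).card by omega)
          obtain ⟨hvX, hva⟩ := Finset.mem_filter.1 hv
          rw [Finset.card_erase_of_mem (hva ▸ Finset.mem_image_of_mem _ hvX)] at h2
          omega) (by omega)
      have hg : ∀ v, ∃ c, c ∈ L v ∩ C i := fun v => by
        have := hL v i
        exact Finset.card_pos.1 (by omega)
      choose g hg using hg
      have hdisj : ∀ u v, v ∈ X → ¬ p v = a → g u ≠ f v := fun u v hv hva huv => by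
        have h1 := (Finset.mem_inter.1 (hg u)).2
        have h2 := (Finset.mem_inter.1 (hf v (Finset.mem_filter.2 ⟨hv, hva⟩))).2
        obtain ⟨j, hj, hjc⟩ := Finset.mem_biUnion.1 h2
        exact Finset.disjoint_left.1 (hC i j (Finset.ne_of_mem_erase hj).symm) h1 (huv ▸ hjc)
      refine ⟨fun v => if p v = a then g v else f v, fun v hv => ?_, fun u hu v hv huv => ?_⟩
      · by_cases hva : p v = a
        · simp only [hva, if_true]
          obtain ⟨h1, h2⟩ := Finset.mem_inter.1 (hg v)
          exact Finset.mem_inter.2 ⟨h1, Finset.mem_biUnion.2 ⟨i, hi, h2⟩⟩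
        · simp only [hva, if_false]
          exact Finset.inter_subset_inter_left (Finset.biUnion_subset_biUnion_of_subset_left _
            (Finset.erase_subset _ _)) (hf v (Finset.mem_filter.2 ⟨hv, hva⟩))
      · by_cases hua : p u = a <;> by_cases hva : p v = a
        · rw [hua, hva]
        · simp only [hua, hva, if_true, if_false] at huv
          exact absurd huv (hdisj u v hv hva)
        · simp only [hua, hva, if_true, if_false] at huv
          exact absurd huv.symm (hdisj v u hu hua)
        · simp only [hua, hva, if_false] at huv
          exact hfp u (Finset.mem_filter.2 ⟨hu, hua⟩) v (Finset.mem_filter.2 ⟨hv, hva⟩) huv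
    · refine partColourable_of_card_le X.card p X (∑ i ∈ J, w i) _ rfl hp ?_ fun v _ => ?_
      · rw [not_and_or] at hcase
        rcases hcase with h1 | h1
        · have : J.filter (fun i => w i = 1) = ∅ :=
            Finset.filter_eq_empty_iff.2 fun i hi hwi => h1 ⟨i, hi, hwi⟩
          rw [this, Finset.card_empty] at hX
          exact hX
        · have h2 := Finset.card_le_mul_card_image X (f := p) 2 fun a _ => by
            by_contra hcon
            exact h1 ⟨a, by omega⟩
          omega
      · rw [Finset.inter_biUnion, Finset.card_biUnion]
        · exact Finset.sum_le_sum fun i _ => hL v i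
        · intro i _ j _ hij
          exact Finset.disjoint_of_subset_left Finset.inter_subset_right
            (Finset.disjoint_of_subset_right Finset.inter_subset_right (hC i j hij))

theorem card_filter_get_eq_count (l : List ℕ) (a : ℕ) :
    (Finset.univ.filter (fun i : Fin l.length => l.get i = a)).card = l.count a := by
  rw [Finset.card_filter]
  have h := Fin.sum_univ_fun_getElem l (fun x => if x = a then 1 else 0)
  simp only [List.get_eq_getElem]
  refine h.trans ?_
  induction l with
  | nil => rfl
  | cons x l ih =>
    rw [List.map_cons, List.sum_cons, ih (Fin.sum_univ_fun_getElem l (fun x => if x = a then 1 else 0)), List.count_cons]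
    simp [add_comm]

theorem lamChoosable_of_card_lt (lam : Multiset ℕ) {V : Type*} [Fintype V] (G : SimpleGraph V)
    (hG : G.Colorable lam.sum)
    (hV : Fintype.card V < 2 * lam.sum + lam.count 1 + 2) : LamChoosable G lam := by
  rintro L ⟨l, C, rfl, hC, hL⟩
  obtain ⟨c⟩ := hG
  have hsum : ∑ i, l.get i = (l : Multiset ℕ).sum := by
    rw [Multiset.sum_coe]
    exact Fin.sum_univ_getElem l
  have hcount := card_filter_get_eq_count l 1
  rw [← Multiset.coe_count] at hcount
  obtain ⟨f, hf, hfp⟩ := partColourable_of_isLamAssignment (fun v => (c v : ℕ)) l.get C hC L hL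
    Finset.univ Finset.univ (by
      rw [hsum]
      have h1 : Finset.univ.image (fun v => (c v : ℕ)) ⊆ Finset.range (l : Multiset ℕ).sum := by
        intro a ha
        obtain ⟨v, _, rfl⟩ := Finset.mem_image.1 ha
        exact Finset.mem_range.2 (c v).2
      simpa using Finset.card_le_card h1) (by
      rw [hsum, hcount, Finset.card_univ]
      omega)
  refine ⟨f, fun v => (Finset.mem_inter.1 (hf v (Finset.mem_univ _))).1, fun u v huv hfuv => ?_⟩
  exact c.valid huv (Fin.ext (hfp u (Finset.mem_univ _) v (Finset.mem_univ _) hfuv))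

section Example

/-- The part containing a vertex of the complete multipartite graph with triple parts indexed by
`A` and singleton parts indexed by `S`. -/
def tripleLabel {A S : Type*} : (A × Fin 3) ⊕ S → A ⊕ S := Sum.map Prod.fst id

/-- Colours have a type in `Fin 4`, and the `r`-th vertex of a triple avoids the colours of type
`r`. Then each triple uses a colour of type `3` or two colours, which bounds the number of
parts. -/
theorem two_mul_card_add_card_le_sum_weight {A S κ : Type*} [Fintype A] [Fintype S] [Fintype κ]
    (ty : κ → Fin 4) (f : (A × Fin 3) ⊕ S → κ)
    (hf : ∀ a r, ty (f (Sum.inl (a, r))) ≠ r.castSucc)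
    (hprop : ∀ u v, f u = f v → tripleLabel u = tripleLabel v) :
    2 * Fintype.card A + Fintype.card S ≤ ∑ c, if ty c = 3 then 2 else 1 := by
  classical
  set wt : κ → ℕ := fun c => if ty c = 3 then 2 else 1 with hwt
  have hwt1 : ∀ c, 1 ≤ wt c := fun c => by simp only [hwt]; split_ifs <;> omega
  let used : A ⊕ S → Finset κ := fun b =>
    Finset.univ.filter (fun c => ∃ v, tripleLabel v = b ∧ f v = c)
  have hmem : ∀ v, f v ∈ used (tripleLabel v) := fun v =>
    Finset.mem_filter.2 ⟨Finset.mem_univ _, v, rfl, rfl⟩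
  have hdisj : ∀ b ∈ (Finset.univ : Finset (A ⊕ S)), ∀ b' ∈ (Finset.univ : Finset (A ⊕ S)),
      b ≠ b' → Disjoint (used b) (used b') := by
    intro b _ b' _ hne
    rw [Finset.disjoint_left]
    intro c hc hc'
    obtain ⟨v, rfl, hv⟩ := (Finset.mem_filter.1 hc).2
    obtain ⟨u, rfl, hu⟩ := (Finset.mem_filter.1 hc').2
    exact hne (hprop v u (hv.trans hu.symm))
  have hle : ∑ b, ∑ c ∈ used b, wt c ≤ ∑ c, wt c := by
    rw [← Finset.sum_biUnion hdisj]
    exact Finset.sum_le_sum_of_subset (Finset.subset_univ _)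
  refine le_trans ?_ hle
  rw [Fintype.sum_sum_type]
  refine add_le_add ?_ ?_
  · rw [mul_comm, ← smul_eq_mul, ← Finset.card_univ]
    refine Finset.card_nsmul_le_sum _ _ _ fun a _ => ?_
    have h0 := hmem (Sum.inl (a, 0))
    by_cases h3 : ty (f (Sum.inl (a, 0))) = 3
    · refine le_trans ?_ (Finset.single_le_sum (f := wt) (fun _ _ => Nat.zero_le _) h0)
      simp [hwt, h3]
    · obtain ⟨r, hr⟩ : ∃ r : Fin 3, r.castSucc = ty (f (Sum.inl (a, 0))) :=
        Fin.exists_castSucc_eq.2 h3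
      have hne : f (Sum.inl (a, 0)) ≠ f (Sum.inl (a, r)) := by
        intro heq
        exact hf a r (by rw [← heq, hr])
      have hsub : {f (Sum.inl (a, 0)), f (Sum.inl (a, r))} ⊆ used (Sum.inl a) := by
        intro c hc
        rcases Finset.mem_insert.1 hc with rfl | hc
        · exact h0
        · rw [Finset.mem_singleton.1 hc]
          exact hmem (Sum.inl (a, r))
      refine le_trans ?_ (Finset.sum_le_sum_of_subset hsub)
      rw [Finset.sum_pair hne]
      exact add_le_add (hwt1 _) (hwt1 _)
  · rw [← Finset.card_univ, ← mul_one (Finset.card _), ← smul_eq_mul]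
    refine Finset.card_nsmul_le_sum _ _ _ fun s _ => ?_
    exact le_trans (hwt1 _)
      (Finset.single_le_sum (f := wt) (fun _ _ => Nat.zero_le _) (hmem (Sum.inr s)))

theorem chromaticNumber_comap_top {V B : Type*} [Fintype B] (q : V → B)
    (hq : Function.Surjective q) :
    ((⊤ : SimpleGraph B).comap q).chromaticNumber = Fintype.card B := by
  rw [← SimpleGraph.chromaticNumber_top (V := B)]
  refine le_antisymm (SimpleGraph.chromaticNumber_mono_of_hom (SimpleGraph.Hom.comap q ⊤))
    (SimpleGraph.chromaticNumber_mono_of_hom ⟨Function.surjInv hq, fun {a b} hab => ?_⟩)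
  simpa [Function.surjInv_eq hq] using hab

/-- The number of colours of type `j` in a colour set of size parameter `w`. -/
def colourCap (w : ℕ) (j : Fin 4) : ℕ := if j = 3 then w % 2 else w / 2

/-- The colours: for each `i`, there are `colourCap (w i) j` colours of type `j`. -/
abbrev ExampleColour {ι : Type*} (w : ι → ℕ) : Type _ :=
  (i : ι) × (j : Fin 4) × Fin (colourCap (w i) j)

theorem sum_colourCap (w : ℕ) (r : Fin 3) :
    ∑ j ∈ Finset.univ.filter (fun j => j ≠ r.castSucc), colourCap w j = w := by
  rw [Finset.sum_filter, Fin.sum_univ_four]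
  fin_cases r <;> simp [colourCap] <;> omega

theorem sum_weight_exampleColour {ι : Type*} [Fintype ι] (w : ι → ℕ) :
    ∑ c : ExampleColour w, (if c.2.1 = 3 then 2 else 1) =
      3 * ∑ i, w i / 2 + 2 * ∑ i, w i % 2 := by
  rw [Fintype.sum_sigma, Finset.mul_sum, Finset.mul_sum, ← Finset.sum_add_distrib]
  refine Finset.sum_congr rfl fun i _ => ?_
  have h : ∀ j : Fin 4, ∑ _x : Fin (colourCap (w i) j), (if j = 3 then 2 else 1) =
      colourCap (w i) j * if j = 3 then 2 else 1 := fun j => by simp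
  rw [Fintype.sum_sigma, Finset.sum_congr rfl fun j _ => h j, Fin.sum_univ_four]
  simp [colourCap]
  omega

/-- The lists: the `r`-th vertex of a triple misses the colours of type `r`. -/
def exampleList {ι A S : Type*} [Fintype ι] (w : ι → ℕ) :
    (A × Fin 3) ⊕ S → Finset (ExampleColour w)
  | Sum.inl x => Finset.univ.filter (fun c => c.2.1 ≠ x.2.castSucc)
  | Sum.inr _ => Finset.univ

theorem le_card_exampleList {ι A S : Type*} [Fintype ι] [DecidableEq ι] (w : ι → ℕ)
    (v : (A × Fin 3) ⊕ S) (i : ι) :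
    w i ≤ ((exampleList w v).filter (fun c => c.1 = i)).card := by
  obtain ⟨r, hr⟩ : ∃ r : Fin 3, ∀ c : ExampleColour w, c.2.1 ≠ r.castSucc →
      c ∈ exampleList w v := by
    rcases v with x | s
    · exact ⟨x.2, fun c hc => Finset.mem_filter.2 ⟨Finset.mem_univ _, hc⟩⟩
    · exact ⟨0, fun c _ => Finset.mem_univ _⟩
  calc w i = (((Finset.univ.filter (fun j : Fin 4 => j ≠ r.castSucc)).sigma
        (fun j => (Finset.univ : Finset (Fin (colourCap (w i) j))))).map
          (Function.Embedding.sigmaMk (β := fun i => (j : Fin 4) × Fin (colourCap (w i) j))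
            i)).card := by
        rw [Finset.card_map, Finset.card_sigma]
        simpa using (sum_colourCap (w i) r).symm
    _ ≤ _ := by
        refine Finset.card_le_card fun c hc => ?_
        obtain ⟨y, hy, rfl⟩ := Finset.mem_map.1 hc
        exact Finset.mem_filter.2
          ⟨hr _ (Finset.mem_filter.1 (Finset.mem_sigma.1 hy).1).2, rfl⟩

theorem exists_not_lamChoosable (lam : Multiset ℕ) (hnt : Multiset.card lam < lam.sum)
    (hodd : ∀ x ∈ lam, Odd x → x = 1) :
    ∃ G : SimpleGraph (Fin (2 * lam.sum + lam.count 1 + 2)),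
      G.chromaticNumber = (lam.sum : ℕ∞) ∧ ¬ LamChoosable G lam := by
  obtain ⟨l, rfl⟩ := Quot.exists_rep lam
  change Multiset.card (l : Multiset ℕ) < (l : Multiset ℕ).sum at hnt
  change ∀ x ∈ (l : Multiset ℕ), Odd x → x = 1 at hodd
  change ∃ G : SimpleGraph (Fin (2 * (l : Multiset ℕ).sum + (l : Multiset ℕ).count 1 + 2)),
    G.chromaticNumber = ((l : Multiset ℕ).sum : ℕ∞) ∧ ¬ LamChoosable G (l : Multiset ℕ)
  set k := (l : Multiset ℕ).sum with hk
  set t := (l : Multiset ℕ).count 1 with ht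
  have hsum : ∑ i, l.get i = k := by
    rw [hk, Multiset.sum_coe]
    exact Fin.sum_univ_getElem l
  have hcount : ∑ i, l.get i % 2 = t := by
    rw [ht, Multiset.coe_count, ← card_filter_get_eq_count l 1, Finset.card_filter]
    refine Finset.sum_congr rfl fun i _ => ?_
    have := hodd (l.get i) (Multiset.mem_coe.2 (l.get_mem i))
    rw [Nat.odd_iff] at this
    split_ifs <;> omega
  set m := ∑ i, l.get i / 2 with hm
  have hkm : k = 2 * m + t := by
    rw [← hsum, ← hcount, hm, Finset.mul_sum, ← Finset.sum_add_distrib]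
    exact Finset.sum_congr rfl fun i _ => by omega
  have hm1 : 1 ≤ m := by
    by_contra h0
    have h1 : t ≤ l.length := (Multiset.count_le_card 1 (l : Multiset ℕ))
    rw [Multiset.coe_card] at hnt
    omega
  let A := Fin (m + 1 + t)
  let S := Fin (m - 1)
  have hcard : Fintype.card ((A × Fin 3) ⊕ S) = 2 * k + t + 2 := by
    simp only [A, S, Fintype.card_sum, Fintype.card_prod, Fintype.card_fin]
    omega
  let e : Fin (2 * k + t + 2) ≃ (A × Fin 3) ⊕ S := (Fintype.equivFinOfCardEq hcard).symm
  let q : Fin (2 * k + t + 2) → A ⊕ S := fun v => tripleLabel (e v)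
  have hq : Function.Surjective q := by
    rintro (a | s)
    · exact ⟨e.symm (Sum.inl (a, 0)), by simp [q, tripleLabel]⟩
    · exact ⟨e.symm (Sum.inr s), by simp [q, tripleLabel]⟩
  refine ⟨(⊤ : SimpleGraph (A ⊕ S)).comap q, ?_, fun hch => ?_⟩
  · rw [chromaticNumber_comap_top q hq]
    simp only [A, S, Fintype.card_sum, Fintype.card_fin]
    congr 1
    omega
  · let enc : ExampleColour l.get ↪ ℕ := ⟨Encodable.encode, Encodable.encode_injective⟩
    obtain ⟨f, hf, hprop⟩ := hch (fun v => (exampleList l.get (e v)).map enc)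
      ⟨l, fun i => (Finset.univ.filter (fun c : ExampleColour l.get => c.1 = i)).map enc, rfl, by
        intro i j hij
        rw [Finset.disjoint_map, Finset.disjoint_filter]
        rintro c _ rfl
        exact hij, by
        intro v i
        rw [← Finset.map_inter, Finset.card_map]
        refine (le_card_exampleList l.get (e v) i).trans (Finset.card_le_card fun c hc => ?_)
        obtain ⟨h1, h2⟩ := Finset.mem_filter.1 hc
        exact Finset.mem_inter.2 ⟨h1, Finset.mem_filter.2 ⟨Finset.mem_univ _, h2⟩⟩⟩
    choose g hg hgf using fun v => Finset.mem_map.1 (hf v)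
    have hbound := two_mul_card_add_card_le_sum_weight (fun c : ExampleColour l.get => c.2.1)
      (fun v => g (e.symm v))
      (fun a r => by
        have h := hg (e.symm (Sum.inl (a, r)))
        rw [Equiv.apply_symm_apply] at h
        exact (Finset.mem_filter.1 h).2)
      (fun u v huv => by
        by_contra hne
        refine hprop (u := e.symm u) (w := e.symm v) ?_ ?_
        · simpa [q] using hne
        · rw [← hgf, ← hgf, huv])
    rw [sum_weight_exampleColour, hcount, ← hm] at hbound
    simp only [A, S, Fintype.card_fin] at hbound
    omega

end Example

theorem phi_eq_of_odds_are_one (lam : Multiset ℕ)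
    (hpos : ∀ x ∈ lam, 0 < x) (hnt : Multiset.card lam < lam.sum)
    (hodd : ∀ x ∈ lam, Odd x → x = 1) :
    (∃ G : SimpleGraph (Fin (2 * lam.sum + lam.count 1 + 2)),
        G.chromaticNumber = (lam.sum : ℕ∞) ∧ ¬ LamChoosable G lam) ∧
    (∀ (V : Type) [Fintype V] (G : SimpleGraph V),
        G.chromaticNumber = (lam.sum : ℕ∞) →
        Fintype.card V < 2 * lam.sum + lam.count 1 + 2 →
        LamChoosable G lam) :=
  ⟨exists_not_lamChoosable lam hnt hodd, fun _ _ G hG hV =>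
    lamChoosable_of_card_lt lam G (SimpleGraph.chromaticNumber_le_iff_colorable.1 hG.le) hV⟩
end

section
/- Let λ be a non-trivial multiset of positive integers (i.e. |λ| < k_λ) with sum k_λ, and let 1_λ be the multiplicity of 1 in λ. Then there exists a finite simple graph G with chromatic number equal to k_λ and exactly 2k_λ + 5·1_λ + 3 vertices which is not λ-choosable. -/
open SimpleGraph

/-- Vertices of the complete multipartite graph with one part of size `5`, `m` parts of size `7`
and `κ` parts of size `2`: every part but the first has two pair vertices, and each of the first
`m + 1` parts has five block vertices. -/
abbrev PartVertex (κ m : ℕ) : Type := (Fin (κ + m) × Bool) ⊕ (Fin (m + 1) × Fin 5)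

/-- The part containing a vertex. -/
def partOf (κ m : ℕ) : PartVertex κ m → Fin (κ + m + 1)
  | .inl (i, _) => i.succ
  | .inr (j, _) => j.castLE (by omega)

lemma partOf_surjective (κ m : ℕ) : Function.Surjective (partOf κ m) := by
  intro p
  by_cases hp : p = 0
  · exact ⟨.inr (0, 0), by subst hp; rfl⟩
  · exact ⟨.inl (p.pred hp, false), by simp [partOf]⟩

/-- A complete multipartite graph with `n` non-empty parts has chromatic number `n`. -/
lemma chromaticNumber_comap_top_of_surjective {V : Type*} {n : ℕ} {p : V → Fin n}
    (hp : Function.Surjective p) :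
    ((⊤ : SimpleGraph (Fin n)).comap p).chromaticNumber = n := by
  refine le_antisymm ?_ ?_
  · have h : ((⊤ : SimpleGraph (Fin n)).comap p).Colorable n :=
      ⟨SimpleGraph.Coloring.mk p fun h => h⟩
    exact h.chromaticNumber_le
  · rw [SimpleGraph.le_chromaticNumber_iff_colorable]
    intro c hc
    obtain ⟨col⟩ := hc
    have hinj : Function.Injective fun i => col (Function.surjInv hp i) := by
      intro i j hij
      by_contra hne
      refine col.valid (v := Function.surjInv hp i) (w := Function.surjInv hp j) ?_ hij
      simpa [Function.surjInv_eq hp] using hne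
    simpa using Fintype.card_le_of_injective _ hinj

/-- If an injective map sends at least `|Z| - 1` points into a non-empty `Z`, it misses at most one
element of `Z`. -/
lemma exists_forall_ne_mem_image {α β : Type*} [DecidableEq β] {T : Finset α} {Z : Finset β}
    {g : α → β} (hZ : Z.Nonempty) (hmem : ∀ p ∈ T, g p ∈ Z) (hinj : Set.InjOn g T)
    (hcard : Z.card ≤ T.card + 1) :
    ∃ z ∈ Z, ∀ c ∈ Z, c ≠ z → ∃ p ∈ T, g p = c := by
  have hsub : T.image g ⊆ Z := Finset.image_subset_iff.2 hmem
  have hle : (Z \ T.image g).card ≤ 1 := by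
    rw [Finset.card_sdiff_of_subset hsub, Finset.card_image_of_injOn hinj]
    omega
  rcases (Z \ T.image g).eq_empty_or_nonempty with he | ⟨z, hz⟩
  · obtain ⟨z, hz⟩ := hZ
    exact ⟨z, hz, fun c hc _ => Finset.mem_image.1 (Finset.sdiff_eq_empty_iff_subset.1 he hc)⟩
  · refine ⟨z, (Finset.mem_sdiff.1 hz).1, fun c hc hcz => ?_⟩
    by_contra hno
    exact hcz (Finset.card_le_one.1 hle c
      (Finset.mem_sdiff.2 ⟨hc, fun h => hno (Finset.mem_image.1 h)⟩) z hz)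

/-- If pair vertices are coloured from `Z b ∪ O`, block vertices from lists `F t`, and every choice
of one colour from each `Z b` is avoided by some `F t`, then the colouring is not proper. -/
lemma not_proper_of_block_cover {κ m : ℕ} {O : Finset ℕ} {Z : Bool → Finset ℕ}
    {F : Fin 5 → Finset ℕ} (hO : O.card ≤ m) (hZ : ∀ b, (Z b).card ≤ κ + 1)
    (hne : ∀ b, (Z b).Nonempty) (hF : ∀ t, ∀ c ∈ F t, c ∈ O ∨ ∃ b, c ∈ Z b)
    (hcov : ∀ z : Bool → ℕ, (∀ b, z b ∈ Z b) → ∃ t, ∀ b, z b ∉ F t)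
    (f : PartVertex κ m → ℕ) (hpair : ∀ i b, f (.inl (i, b)) ∈ O ∨ f (.inl (i, b)) ∈ Z b)
    (hblock : ∀ j t, f (.inr (j, t)) ∈ F t) :
    ¬ ∀ u v, partOf κ m u ≠ partOf κ m v → f u ≠ f v := by
  classical
  intro hf
  set Q : Finset (Fin (κ + m + 1)) := {p | ∃ v, partOf κ m v = p ∧ f v ∈ O} with hQ
  have hQO : Q.card ≤ m := by
    refine le_trans (Finset.card_le_card_of_forall_subsingleton
      (fun p c => ∃ v, partOf κ m v = p ∧ f v = c) ?_ ?_) hO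
    · intro p hp
      obtain ⟨v, hv, hvO⟩ := (Finset.mem_filter.1 hp).2
      exact ⟨f v, hvO, v, hv, rfl⟩
    · rintro c - p ⟨-, v, rfl, hv⟩ q ⟨-, w, rfl, hw⟩
      by_contra hpq
      exact hf v w hpq (hv.trans hw.symm)
  have hnotO : ∀ v, partOf κ m v ∉ Q → f v ∉ O := fun v hv h =>
    hv (Finset.mem_filter.2 ⟨Finset.mem_univ _, v, rfl, h⟩)
  obtain ⟨j, hjQ, hj⟩ : ∃ j : Fin (m + 1), partOf κ m (.inr (j, 0)) ∉ Q ∧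
      ∀ p ∉ Q, p ≠ partOf κ m (.inr (j, 0)) → p ≠ 0 := by
    by_cases h0 : (0 : Fin (κ + m + 1)) ∈ Q
    · by_contra! hno
      have hall : ∀ j : Fin (m + 1), partOf κ m (.inr (j, 0)) ∈ Q := by
        intro j
        by_contra hj
        obtain ⟨p, hp, -, rfl⟩ := hno j hj
        exact hp h0
      have := Finset.card_le_card_of_injOn (s := Finset.univ) (t := Q)
        (fun j : Fin (m + 1) => partOf κ m (.inr (j, 0))) (fun j _ => hall j)
        (fun a _ b _ hab => Fin.castLE_injective (by omega) hab)
      simp at this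
      omega
    · exact ⟨0, h0, fun p _ hp => hp⟩
  set T := (Finset.univ \ Q).erase (partOf κ m (.inr (j, 0))) with hT
  have hTcard : κ ≤ T.card := by
    rw [hT, Finset.card_erase_of_mem (by simpa using hjQ),
      Finset.card_sdiff_of_subset (Finset.subset_univ _), Finset.card_univ, Fintype.card_fin]
    omega
  have hTmem : ∀ p ∈ T, p ∉ Q ∧ p ≠ partOf κ m (.inr (j, 0)) := by
    intro p hp
    simp only [hT, Finset.mem_erase, Finset.mem_sdiff, Finset.mem_univ, true_and] at hp
    exact hp.symm
  have hex : ∀ b, ∀ p ∈ T, ∃ v, partOf κ m v = p ∧ f v ∈ Z b := by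
    intro b p hp
    obtain ⟨hpQ, hpj⟩ := hTmem p hp
    have hpart : partOf κ m (.inl (p.pred (hj p hpQ hpj), b)) = p := by simp [partOf]
    refine ⟨_, hpart, (hpair _ b).resolve_left (hnotO _ ?_)⟩
    rwa [hpart]
  choose! g hgp hgZ using hex
  have hleft : ∀ b, ∃ z ∈ Z b, ∀ c ∈ Z b, c ≠ z → ∃ p ∈ T, f (g b p) = c := by
    intro b
    refine exists_forall_ne_mem_image (hne b) (hgZ b) ?_ ((hZ b).trans (by omega))
    intro p hp q hq hpq
    by_contra h
    exact hf _ _ (by rwa [hgp b p hp, hgp b q hq]) hpq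
  choose z hz hzu using hleft
  obtain ⟨t, ht⟩ := hcov z hz
  rcases hF t _ (hblock j t) with h | ⟨b, hb⟩
  · exact hnotO (.inr (j, t)) hjQ h
  · obtain ⟨p, hp, hpc⟩ := hzu b _ hb fun h => ht b (h ▸ hblock j t)
    exact hf _ _ (by rw [hgp b p hp]; exact (hTmem p hp).2) hpc

/-- The list pattern of a pair vertex on a block `{0, …, 2n - 1}` of colours: the lower or the
upper half. -/
def pairPattern (b : Bool) (n : ℕ) : Finset ℕ :=
  if b then Finset.Ico n (2 * n) else Finset.Ico 0 n

/-- The list patterns of the five block vertices on `{0, …, 2n - 1}`: complements of a pinwheel of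
rectangles covering (lower half) × (upper half). -/
def blockPattern (t : Fin 5) (n : ℕ) : Finset ℕ :=
  ![Finset.Ico (n / 2) n ∪ Finset.Ico (2 * n - n / 2) (2 * n),
    Finset.Ico (n - n / 2) (2 * n - n / 2),
    Finset.Ico 0 (n - n / 2) ∪ Finset.Ico n (n + n / 2),
    Finset.Ico 0 (n / 2) ∪ Finset.Ico (n + n / 2) (2 * n),
    Finset.Ico 0 (n / 2) ∪ Finset.Ico (n - n / 2) (n + n / 2) ∪
      Finset.Ico (2 * n - n / 2) (2 * n)] t

lemma le_card_pairPattern (b : Bool) (n : ℕ) : n ≤ (pairPattern b n).card := by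
  cases b <;> simp [pairPattern]
  omega

lemma lt_of_mem_pairPattern {b : Bool} {n c : ℕ} (h : c ∈ pairPattern b n) : c < 2 * n := by
  cases b <;> simp [pairPattern] at h <;> omega

lemma le_card_blockPattern (t : Fin 5) {n : ℕ} (hn : 2 ≤ n) : n ≤ (blockPattern t n).card := by
  have key : ∀ a b c d : ℕ, b ≤ c → Disjoint (Finset.Ico a b) (Finset.Ico c d) := by
    intro a b c d h
    rw [Finset.disjoint_left]
    intro x
    simp only [Finset.mem_Ico]
    omega
  fin_cases t <;> simp only [blockPattern, Fin.reduceFinMk, Fin.zero_eta, Fin.mk_one, Matrix.cons_val]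
  · rw [Finset.card_union_of_disjoint (key _ _ _ _ (by omega))]
    simp only [Nat.card_Ico]
    omega
  · simp only [Nat.card_Ico]
    omega
  · rw [Finset.card_union_of_disjoint (key _ _ _ _ (by omega))]
    simp only [Nat.card_Ico]
    omega
  · rw [Finset.card_union_of_disjoint (key _ _ _ _ (by omega))]
    simp only [Nat.card_Ico]
    omega
  · rw [Finset.card_union_of_disjoint (Finset.disjoint_union_left.2
      ⟨key _ _ _ _ (by omega), key _ _ _ _ (by omega)⟩),
      Finset.card_union_of_disjoint (key _ _ _ _ (by omega))]
    simp only [Nat.card_Ico]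
    omega

lemma lt_of_mem_blockPattern {t : Fin 5} {n c : ℕ} (h : c ∈ blockPattern t n) : c < 2 * n := by
  fin_cases t <;> simp [blockPattern] at h <;> omega

/-- The zone (lower, middle or upper) of a position in a half of size `n`. -/
def zone (n s : ℕ) : Fin 3 := if s < n / 2 then 0 else if s < n - n / 2 then 1 else 2

/-- The index of the pinwheel rectangle containing a pair of zones. -/
def pinwheel (r s : Fin 3) : Fin 5 := !![0, 0, 1; 3, 4, 1; 3, 2, 2] r s

lemma notMem_blockPattern_lower {n x : ℕ} (hx : x < n) (s : Fin 3) :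
    x ∉ blockPattern (pinwheel (zone n x) s) n := by
  unfold zone
  split_ifs <;> fin_cases s <;> simp [pinwheel, blockPattern] <;> omega

lemma notMem_blockPattern_upper {n y : ℕ} (hy : n ≤ y) (hy' : y < 2 * n) (r : Fin 3) :
    y ∉ blockPattern (pinwheel r (zone n (y - n))) n := by
  unfold zone
  split_ifs <;> fin_cases r <;> simp [pinwheel, blockPattern] <;> omega

/-- The colours `Nat.pair i c` with `c ∈ S n`, where `n` is the `i`-th entry of `l`. -/
def spread (l : List ℕ) (S : ℕ → Finset ℕ) : Finset ℕ :=
  Finset.univ.biUnion fun i : Fin l.length => (S (l.get i)).image (Nat.pair i)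

lemma mem_spread {l : List ℕ} {S : ℕ → Finset ℕ} {c : ℕ} :
    c ∈ spread l S ↔ ∃ i : Fin l.length, ∃ x ∈ S (l.get i), Nat.pair i x = c := by
  simp [spread]

lemma pair_mem_spread {l : List ℕ} {S : ℕ → Finset ℕ} {i : Fin l.length} {x : ℕ} :
    Nat.pair i x ∈ spread l S ↔ x ∈ S (l.get i) := by
  rw [mem_spread]
  constructor
  · rintro ⟨j, y, hy, h⟩
    obtain ⟨hij, rfl⟩ := Nat.pair_eq_pair.1 h
    rwa [← Fin.ext hij]
  · exact fun h => ⟨i, x, h, rfl⟩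

lemma card_spread_le (l : List ℕ) (S : ℕ → Finset ℕ) :
    (spread l S).card ≤ (l.map fun n => (S n).card).sum := by
  calc (spread l S).card
      ≤ ∑ i : Fin l.length, ((S (l.get i)).image (Nat.pair i)).card := Finset.card_biUnion_le
    _ ≤ ∑ i : Fin l.length, (S (l.get i)).card :=
        Finset.sum_le_sum fun i _ => Finset.card_image_le
    _ = (l.map fun n => (S n).card).sum := by
        simpa using Fin.sum_univ_fun_getElem l fun n => (S n).card

lemma isLamAssignment_spread {V : Type*} (l : List ℕ) (S : V → ℕ → Finset ℕ)
    (hcard : ∀ v, ∀ n ∈ l, n ≤ (S v n).card) (hlt : ∀ v, ∀ n ∈ l, ∀ c ∈ S v n, c < 2 * n) :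
    IsLamAssignment (l : Multiset ℕ) fun v => spread l (S v) := by
  refine ⟨l, fun i => (Finset.range (2 * l.get i)).image (Nat.pair i), rfl, ?_, ?_⟩
  · intro i j hij
    rw [Finset.disjoint_left]
    intro c hc hc'
    obtain ⟨x, -, rfl⟩ := Finset.mem_image.1 hc
    obtain ⟨y, -, h⟩ := Finset.mem_image.1 hc'
    exact hij (Fin.ext (Nat.pair_eq_pair.1 h).1.symm)
  · intro v i
    have hi : l.get i ∈ l := List.get_mem l i
    refine (hcard v _ hi).trans ?_
    rw [← Finset.card_image_of_injective (S v (l.get i))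
      (fun x y h => (Nat.pair_eq_pair.1 h).2 : Function.Injective (Nat.pair i))]
    refine Finset.card_le_card fun c hc => ?_
    obtain ⟨x, hx, rfl⟩ := Finset.mem_image.1 hc
    exact Finset.mem_inter.2 ⟨pair_mem_spread.2 hx,
      Finset.mem_image_of_mem _ (Finset.mem_range.2 (hlt v _ hi x hx))⟩

/-- The pattern `S`, except that a block of size `1` contributes its single colour `0`. -/
def withOnes (S : ℕ → Finset ℕ) (n : ℕ) : Finset ℕ := if n = 1 then {0} else S n

/-- The pattern `S` on blocks of size other than `1`. -/
def withoutOnes (S : ℕ → Finset ℕ) (n : ℕ) : Finset ℕ := if n = 1 then ∅ else S n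

/-- The list pattern of a vertex. -/
def vertexPattern {κ m : ℕ} : PartVertex κ m → ℕ → Finset ℕ
  | .inl (_, b) => withOnes (pairPattern b)
  | .inr (_, t) => withOnes (blockPattern t)

lemma le_card_vertexPattern {κ m : ℕ} (v : PartVertex κ m) {n : ℕ} (hn : 0 < n) :
    n ≤ (vertexPattern v n).card := by
  rcases v with ⟨_, b⟩ | ⟨_, t⟩ <;> simp only [vertexPattern, withOnes] <;> split_ifs with h
  · simp [h]
  · exact le_card_pairPattern b n
  · simp [h]
  · exact le_card_blockPattern t (by omega)

lemma lt_of_mem_vertexPattern {κ m : ℕ} {v : PartVertex κ m} {n c : ℕ}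
    (h : c ∈ vertexPattern v n) : c < 2 * n := by
  rcases v with ⟨_, b⟩ | ⟨_, t⟩ <;> simp only [vertexPattern, withOnes] at h <;> split_ifs at h
  · simp at h; omega
  · exact lt_of_mem_pairPattern h
  · simp at h; omega
  · exact lt_of_mem_blockPattern h

lemma sum_map_card_withOnes_empty (l : List ℕ) :
    (l.map fun n => (withOnes (fun _ => ∅) n).card).sum = l.count 1 := by
  induction l with
  | nil => simp
  | cons a l ih =>
    by_cases h : a = 1
    · rw [List.map_cons, List.sum_cons, ih]
      simp [h, withOnes, add_comm]
    · rw [List.map_cons, List.sum_cons, ih]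
      simp [h, withOnes]

lemma sum_map_card_withoutOnes_pairPattern (l : List ℕ) (b : Bool) :
    (l.map fun n => (withoutOnes (pairPattern b) n).card).sum + l.count 1 = l.sum := by
  have hcard : ∀ n, (pairPattern b n).card = n := by
    intro n
    cases b <;> simp [pairPattern]
    omega
  induction l with
  | nil => simp
  | cons a l ih =>
    by_cases h : a = 1
    · simp [← ih, h, withoutOnes]
      omega
    · simp [← ih, h, withoutOnes, hcard]
      omega

lemma mem_spread_withOnes {l : List ℕ} {S : ℕ → Finset ℕ} {c : ℕ} (h : c ∈ spread l (withOnes S)) :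
    c ∈ spread l (withOnes fun _ => ∅) ∨ c ∈ spread l (withoutOnes S) := by
  obtain ⟨i, x, hx, rfl⟩ := mem_spread.1 h
  rw [pair_mem_spread, pair_mem_spread]
  unfold withOnes withoutOnes at *
  split_ifs at * <;> simp_all

lemma exists_pairPattern_of_mem_blockPattern {t : Fin 5} {n c : ℕ} (h : c ∈ blockPattern t n) :
    ∃ b, c ∈ pairPattern b n := by
  have := lt_of_mem_blockPattern h
  by_cases hc : c < n
  · exact ⟨false, by simpa [pairPattern] using hc⟩
  · exact ⟨true, by simp [pairPattern]; omega⟩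

lemma exists_spread_of_mem_spread_blockPattern {l : List ℕ} {t : Fin 5} {c : ℕ}
    (h : c ∈ spread l (withoutOnes (blockPattern t))) :
    ∃ b, c ∈ spread l (withoutOnes (pairPattern b)) := by
  obtain ⟨i, x, hx, rfl⟩ := mem_spread.1 h
  unfold withoutOnes at hx
  split_ifs at hx with h1
  · simp at hx
  · obtain ⟨b, hb⟩ := exists_pairPattern_of_mem_blockPattern hx
    exact ⟨b, pair_mem_spread.2 (by simpa only [withoutOnes, if_neg h1] using hb)⟩

lemma exists_forall_notMem_spread_blockPattern {l : List ℕ} (z : Bool → ℕ)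
    (hz : ∀ b, z b ∈ spread l (withoutOnes (pairPattern b))) :
    ∃ t, ∀ b, z b ∉ spread l (withOnes (blockPattern t)) := by
  obtain ⟨i, x, hx, hzx⟩ := mem_spread.1 (hz false)
  obtain ⟨j, y, hy, hzy⟩ := mem_spread.1 (hz true)
  unfold withoutOnes at hx hy
  split_ifs at hx with hi
  · simp at hx
  split_ifs at hy with hj
  · simp at hy
  simp only [pairPattern, Bool.false_eq_true, if_false, if_true, Finset.mem_Ico] at hx hy
  refine ⟨pinwheel (zone (l.get i) x) (zone (l.get j) (y - l.get j)), ?_⟩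
  rintro (_ | _)
  · rw [← hzx, pair_mem_spread, withOnes, if_neg hi]
    exact notMem_blockPattern_lower hx.2 _
  · rw [← hzy, pair_mem_spread, withOnes, if_neg hj]
    exact notMem_blockPattern_upper hy.1 hy.2 _

lemma spread_pairPattern_nonempty {l : List ℕ} (hl : ∃ n ∈ l, 2 ≤ n) (b : Bool) :
    (spread l (withoutOnes (pairPattern b))).Nonempty := by
  obtain ⟨n, hn, h2⟩ := hl
  obtain ⟨i, rfl⟩ := List.get_of_mem hn
  have hpos : 0 < (pairPattern b (l.get i)).card :=
    lt_of_lt_of_le (by omega) (le_card_pairPattern b (l.get i))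
  obtain ⟨x, hx⟩ := Finset.card_pos.1 hpos
  exact ⟨Nat.pair i x, pair_mem_spread.2
    (by simpa only [withoutOnes, if_neg (show l.get i ≠ 1 by omega)] using hx)⟩

theorem exists_non_choosable_graph (lam : Multiset ℕ)
    (hpos : ∀ x ∈ lam, 0 < x) (hnt : Multiset.card lam < lam.sum) :
    ∃ G : SimpleGraph (Fin (2 * lam.sum + 5 * lam.count 1 + 3)),
      G.chromaticNumber = (lam.sum : ℕ∞) ∧ ¬ LamChoosable G lam := by
  obtain ⟨l, rfl⟩ := Quot.exists_rep lam
  change (∀ x ∈ l, 0 < x) at hpos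
  change l.length < (l : Multiset ℕ).sum at hnt
  change ∃ G : SimpleGraph (Fin (2 * (l : Multiset ℕ).sum + 5 * (l : Multiset ℕ).count 1 + 3)),
    G.chromaticNumber = ((l : Multiset ℕ).sum : ℕ∞) ∧ ¬ LamChoosable G (l : Multiset ℕ)
  rw [Multiset.sum_coe] at hnt
  rw [Multiset.sum_coe, Multiset.coe_count]
  have hbig : ∃ n ∈ l, 2 ≤ n := by
    by_contra! hno
    have := List.sum_le_card_nsmul l 1 fun n hn => by have := hno n hn; omega
    simp at this
    omega
  have hcardZ := fun b => card_spread_le l (withoutOnes (pairPattern b))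
  have hsum := sum_map_card_withoutOnes_pairPattern l
  obtain ⟨κ, hκ⟩ : ∃ κ, l.sum = κ + l.count 1 + 1 := by
    refine ⟨l.sum - l.count 1 - 1, ?_⟩
    have := Finset.card_pos.2 (spread_pairPattern_nonempty hbig false)
    have := hcardZ false
    have := hsum false
    omega
  let e : Fin (2 * l.sum + 5 * l.count 1 + 3) ≃ PartVertex κ (l.count 1) :=
    Fintype.equivOfCardEq (by simp [hκ]; ring)
  refine ⟨(⊤ : SimpleGraph (Fin (κ + l.count 1 + 1))).comap (partOf κ (l.count 1) ∘ e), ?_, ?_⟩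
  · rw [chromaticNumber_comap_top_of_surjective
      ((partOf_surjective κ (l.count 1)).comp e.surjective), hκ]
  · intro hch
    obtain ⟨f, hfL, hf⟩ := hch (fun v => spread l (vertexPattern (e v)))
      (isLamAssignment_spread l (fun v => vertexPattern (e v))
        (fun v n hn => le_card_vertexPattern _ (hpos n hn))
        (fun v n _ c hc => lt_of_mem_vertexPattern hc))
    have hL : ∀ v, f (e.symm v) ∈ spread l (vertexPattern v) := fun v => by
      simpa using hfL (e.symm v)
    refine not_proper_of_block_cover (O := spread l (withOnes fun _ => ∅))
      (Z := fun b => spread l (withoutOnes (pairPattern b)))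
      (F := fun t => spread l (withOnes (blockPattern t)))
      ((card_spread_le l _).trans (sum_map_card_withOnes_empty l).le)
      (fun b => by have := hcardZ b; have := hsum b; omega)
      (spread_pairPattern_nonempty hbig)
      (fun t c hc => (mem_spread_withOnes hc).imp_right exists_spread_of_mem_spread_blockPattern)
      exists_forall_notMem_spread_blockPattern
      (fun v => f (e.symm v)) (fun i b => mem_spread_withOnes (hL (.inl (i, b))))
      (fun j t => hL (.inr (j, t))) fun u v huv => hf ?_
    simpa using huv
end
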